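/- For all integers r ≥ 3 and q ≥ 2 and every ε > 0, there exist ζ > 0 and n₀ such that the following holds for all n ≥ n₀ with r | n: if G is an n-vertex graph with minimum degree δ(G) ≥ (r/(r+1) + ε)·n and f : E(G) → {1,…,q} is any q-edge-coloring of G, then there is a K_r-tiling T of G and a color c ∈ {1,…,q} such that c appears on at least (e(T) + ζn)/q of the edges of T (i.e., T has discrepancy at least ζn). In other words, δ_{r,q} ≤ r/(r+1) for all r ≥ 3 and q ≥ 2. -/

import Mathlib

open Finset

variable {V : Type*}

/-- A `Kᵣ`-tiling of the vertex set `W`: a collection of pairwise-disjoint `r`-cliques of `G`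
whose union is `W`. -/
def IsKrTilingOn [DecidableEq V] (G : SimpleGraph V) (r : ℕ)
    (T : Finset (Finset V)) (W : Finset V) : Prop :=
  (∀ K ∈ T, G.IsNClique r K) ∧
  (∀ K ∈ T, ∀ K' ∈ T, K ≠ K' → Disjoint K K') ∧
  T.biUnion id = W

/-- A perfect `Kᵣ`-tiling of `G`. -/
def IsKrTiling [Fintype V] [DecidableEq V] (G : SimpleGraph V) (r : ℕ)
    (T : Finset (Finset V)) : Prop :=
  IsKrTilingOn G r T Finset.univ

/-- The number of edges of color `c` lying inside the cliques of `T`. -/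
def tilingColorCount [DecidableEq V] {q : ℕ} (f : Sym2 V → Fin q)
    (T : Finset (Finset V)) (c : Fin q) : ℕ :=
  ∑ K ∈ T, (K.sym2.filter fun e => ¬ e.IsDiag ∧ f e = c).card

/-- The total number of edges lying inside the cliques of `T`. -/
def tilingEdgeCount [DecidableEq V] (T : Finset (Finset V)) : ℕ :=
  ∑ K ∈ T, (K.sym2.filter fun e => ¬ e.IsDiag).card

/-! ### Part 1: reachability in digraphs -/

/-- `a` can be reached from the given vertex in exactly `n` steps. -/
def StepsTo {α : Type*} (R : α → α → Prop) (a : α) : ℕ → α → Prop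
  | 0, i => i = a
  | n + 1, i => ∃ j, R i j ∧ StepsTo R a n j

theorem StepsTo.reach {α : Type*} {R : α → α → Prop} {a : α} :
    ∀ {n : ℕ} {i : α}, StepsTo R a n i → Relation.ReflTransGen R i a
  | 0, _, h => by cases h; exact .refl
  | _ + 1, _, ⟨_, h1, h2⟩ => .head h1 h2.reach

theorem exists_stepsTo {α : Type*} {R : α → α → Prop} {a i : α}
    (h : Relation.ReflTransGen R i a) : ∃ n, StepsTo R a n i := by
  induction h using Relation.ReflTransGen.head_induction_on with
  | refl => exact ⟨0, rfl⟩
  | head h1 _ ih =>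
    obtain ⟨n, hn⟩ := ih
    exact ⟨n + 1, _, h1, hn⟩

theorem exists_rank {α : Type*} (R : α → α → Prop) (a : α) :
    ∃ ρ : α → ℕ, ∀ i, Relation.ReflTransGen R i a → i ≠ a →
      ∃ j, R i j ∧ Relation.ReflTransGen R j a ∧ ρ j < ρ i := by
  refine ⟨fun i => sInf {n | StepsTo R a n i}, fun i hi hne => ?_⟩
  have hmem : StepsTo R a (sInf {n | StepsTo R a n i}) i := Nat.sInf_mem (exists_stepsTo hi)
  rcases hk : sInf {n | StepsTo R a n i} with _ | k
  · rw [hk] at hmem; exact absurd hmem hne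
  · rw [hk] at hmem
    obtain ⟨j, hj, hs⟩ := hmem
    refine ⟨j, hj, hs.reach, ?_⟩
    have : sInf {n | StepsTo R a n j} ≤ k := Nat.sInf_le hs
    show sInf {n | StepsTo R a n j} < sInf {n | StepsTo R a n i}
    omega

/-- The relation `R` with the point `u` deleted. -/
def Rav {α : Type*} (R : α → α → Prop) (u : α) (i j : α) : Prop := R i j ∧ i ≠ u ∧ j ≠ u

theorem avoid_of_rank {α : Type*} {R : α → α → Prop} {a : α} {ρ : α → ℕ}
    (hρ : ∀ i, Relation.ReflTransGen R i a → i ≠ a →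
      ∃ j, R i j ∧ Relation.ReflTransGen R j a ∧ ρ j < ρ i) :
    ∀ (n : ℕ) (i : α), ρ i = n → Relation.ReflTransGen R i a → ∀ w, w ≠ i → ρ i ≤ ρ w →
      Relation.ReflTransGen (Rav R w) i a := by
  intro n
  induction n using Nat.strong_induction_on with
  | _ n ih =>
    intro i hn hi w hw hle
    by_cases hia : i = a
    · subst hia; exact .refl
    · obtain ⟨j, h1, h2, h3⟩ := hρ i hi hia
      have hjw : j ≠ w := by rintro rfl; omega
      exact .head ⟨h1, hw.symm, hjw⟩ (ih (ρ j) (by omega) j rfl h2 w hjw.symm (by omega))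

theorem reach_through {α : Type*} {R : α → α → Prop} {a u w x : α}
    (h : Relation.ReflTransGen (Rav R u) x a) :
    ¬ Relation.ReflTransGen (Rav R w) x a → x ≠ w → Relation.ReflTransGen (Rav R u) w a := by
  induction h using Relation.ReflTransGen.head_induction_on with
  | refl => intro h; exact absurd .refl h
  | head h1 h2 ih =>
    rename_i x j
    intro hn hx
    by_cases hj : j = w
    · subst hj; exact h2
    · exact ih (fun h => hn (.head ⟨h1.1, hx, hj⟩ h)) hj

theorem exists_terminal {α : Type*} [DecidableEq α] (R : α → α → Prop) (a : α) (A : Finset α)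
    (hA : ∀ i ∈ A, Relation.ReflTransGen R i a) (haA : a ∈ A) (hne : ∃ i ∈ A, i ≠ a) :
    ∃ u : α, ∃ A' : Finset α, A' ⊆ A ∧ A'.Nonempty ∧ a ∉ A' ∧
      (∀ w ∈ A', ∀ i ∈ A, i ≠ w → Relation.ReflTransGen (Rav R w) i a) ∧
      (∀ x ∈ A', ∀ j ∈ A, j ∉ A' → j ≠ u → ¬ R x j) := by
  classical
  obtain ⟨ρ, hρ⟩ := exists_rank R a
  let D : α → Finset α := fun u => A.filter fun i => i ≠ u ∧ ¬ Relation.ReflTransGen (Rav R u) i a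
  have hD : ∀ u i, i ∈ D u ↔ i ∈ A ∧ i ≠ u ∧ ¬ Relation.ReflTransGen (Rav R u) i a := by
    intro u i; simp [D]
  have hDa : (D a).Nonempty := by
    obtain ⟨i, hi, hia⟩ := hne
    refine ⟨i, (hD _ _).2 ⟨hi, hia, fun h => ?_⟩⟩
    rcases Relation.ReflTransGen.cases_tail h with h | ⟨j, _, h⟩
    · exact hia h.symm
    · exact h.2.2 rfl
  have hS : (A.filter fun u => (D u).Nonempty).Nonempty := ⟨a, by simp [haA, hDa]⟩
  obtain ⟨u, hu, hmin⟩ := Finset.exists_min_image _ (fun u => #(D u)) hS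
  rw [Finset.mem_filter] at hu
  refine ⟨u, D u, Finset.filter_subset _ _, hu.2, ?_, ?_, ?_⟩
  · intro h
    exact ((hD _ _).1 h).2.2 .refl
  · intro w hw i hi hiw
    have hw' := (hD _ _).1 hw
    by_contra hcon
    have hDw : (D w).Nonempty := ⟨i, (hD _ _).2 ⟨hi, hiw, hcon⟩⟩
    have hle := hmin w (by simp [hw'.1, hDw])
    have huw : Relation.ReflTransGen (Rav R w) u a := by
      rcases le_total (ρ u) (ρ w) with h | h
      · exact avoid_of_rank hρ _ u rfl (hA u hu.1) w hw'.2.1 h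
      · exact absurd (avoid_of_rank hρ _ w rfl (hA w hw'.1) u hw'.2.1.symm h) hw'.2.2
    have hss : D w ⊂ D u := by
      refine (Finset.ssubset_iff_of_subset ?_).2 ⟨w, hw, fun h => ((hD _ _).1 h).2.1 rfl⟩
      intro x hx
      have hx' := (hD _ _).1 hx
      refine (hD _ _).2 ⟨hx'.1, ?_, fun h => ?_⟩
      · rintro rfl; exact hx'.2.2 huw
      · exact hw'.2.2 (reach_through h hx'.2.2 hx'.2.1)
    have := Finset.card_lt_card hss
    omega
  · intro x hx j hj hjD hju hR
    have hx' := (hD _ _).1 hx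
    have : Relation.ReflTransGen (Rav R u) j a := by
      by_contra hcon
      exact hjD ((hD _ _).2 ⟨hj, hju, hcon⟩)
    exact hx'.2.2 (.head ⟨hR, hx'.2.1, hju⟩ this)

/-! ### Part 2: shifting colour classes -/

/-- Colour class. -/
def cls (U : Finset V) (c : V → ℕ) (i : ℕ) : Finset V := U.filter fun v => c v = i

theorem mem_cls {U : Finset V} {c : V → ℕ} {i : ℕ} {v : V} :
    v ∈ cls U c i ↔ v ∈ U ∧ c v = i := by simp [cls]

open Classical in
/-- The neighbours of `v` in `S`. -/
noncomputable def nb (H : SimpleGraph V) (S : Finset V) (v : V) : Finset V :=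
  S.filter fun w => H.Adj v w

theorem mem_nb {H : SimpleGraph V} {S : Finset V} {v w : V} :
    w ∈ nb H S v ↔ w ∈ S ∧ H.Adj v w := by simp [nb]

/-- Proper colouring of `U` with colours in `C`. -/
def PC (H : SimpleGraph V) (U : Finset V) (C : Finset ℕ) (c : V → ℕ) : Prop :=
  (∀ v ∈ U, c v ∈ C) ∧ ∀ v ∈ U, ∀ w ∈ U, H.Adj v w → c v ≠ c w

/-- Equitable colourability. -/
def Equit (H : SimpleGraph V) (U : Finset V) (C : Finset ℕ) (s : ℕ) : Prop :=
  ∃ c : V → ℕ, PC H U C c ∧ ∀ i ∈ C, #(cls U c i) = s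

/-- Some vertex of class `i` has no neighbour in class `j`. -/
def Mv (H : SimpleGraph V) (U : Finset V) (c : V → ℕ) (i j : ℕ) : Prop :=
  ∃ v ∈ U, c v = i ∧ ∀ w ∈ U, c w = j → ¬ H.Adj v w

theorem card_cls_update [DecidableEq V] (U : Finset V) (c : V → ℕ) (v : V) (hv : v ∈ U)
    (i j : ℕ) (hi : c v = i) (l : ℕ) :
    #(cls U (Function.update c v j) l) + (if l = i then 1 else 0) =
      #(cls U c l) + (if l = j then 1 else 0) := by
  have h1 : ∀ d : V → ℕ, #(cls U d l) = #(cls (U.erase v) d l) + (if l = d v then 1 else 0) := by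
    intro d
    conv_lhs => rw [← Finset.insert_erase hv]
    unfold cls
    rw [Finset.filter_insert]
    split_ifs with h2 h3 h3
    · rw [Finset.card_insert_of_notMem (by simp)]
    · exact absurd h2.symm h3
    · exact absurd h3.symm h2
    · rfl
  rw [h1, h1 c]
  have h2 : cls (U.erase v) (Function.update c v j) l = cls (U.erase v) c l := by
    unfold cls
    apply Finset.filter_congr
    intro x hx
    rw [Function.update_of_ne (Finset.ne_of_mem_erase hx)]
  rw [h2, Function.update_self, hi]
  omega

theorem shift [DecidableEq V] (H : SimpleGraph V) (U : Finset V) (C : Finset ℕ) (c : V → ℕ)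
    (hc : PC H U C c) (a : ℕ) (P : Finset ℕ) (hPC : P ⊆ C) (R : ℕ → ℕ → Prop)
    (hR : ∀ i j, R i j → Mv H U c i j ∧ i ∈ P ∧ j ∈ P) (ρ : ℕ → ℕ)
    (hρ : ∀ i, Relation.ReflTransGen R i a → i ≠ a →
      ∃ j, R i j ∧ Relation.ReflTransGen R j a ∧ ρ j < ρ i) :
    ∀ (n : ℕ) (i : ℕ), ρ i = n → Relation.ReflTransGen R i a →
      ∃ c' : V → ℕ, PC H U C c' ∧
        (∀ x ∈ U, c' x ≠ c x → ρ (c x) ≤ ρ i ∧ ρ (c' x) ≤ ρ i ∧ c x ∈ P ∧ c' x ∈ P) ∧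
        (∀ x ∈ U, c' x = i → c x = i) ∧
        ∀ l, #(cls U c' l) + (if l = i then 1 else 0) =
          #(cls U c l) + (if l = a then 1 else 0) := by
  intro n
  induction n using Nat.strong_induction_on with
  | _ n ih =>
    intro i hn hi
    by_cases hia : i = a
    · subst hia
      exact ⟨c, hc, fun x _ h => absurd rfl h, fun x _ h => h, fun l => rfl⟩
    obtain ⟨j, h1, h2, h3⟩ := hρ i hi hia
    obtain ⟨c1, hc1, hch, hsub, hcard⟩ := ih (ρ j) (by omega) j rfl h2
    obtain ⟨⟨v, hvU, hvi, hvn⟩, hiP, hjP⟩ := hR i j h1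
    have hv1 : c1 v = i := by
      by_contra h
      have := (hch v hvU (by rw [hvi]; exact h)).1
      rw [hvi] at this; omega
    have hij : j ≠ i := by rintro rfl; omega
    refine ⟨Function.update c1 v j, ⟨?_, ?_⟩, ?_, ?_, ?_⟩
    · intro x hx
      by_cases hxv : x = v
      · subst hxv; rw [Function.update_self]; exact hPC hjP
      · rw [Function.update_of_ne hxv]; exact hc1.1 x hx
    · intro x hx y hy hxy
      by_cases hxv : x = v
      · subst hxv
        rw [Function.update_self, Function.update_of_ne hxy.ne']
        intro h
        exact hvn y hy (hsub y hy h.symm) hxy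
      · by_cases hyv : y = v
        · subst hyv
          rw [Function.update_self, Function.update_of_ne hxv]
          intro h
          exact hvn x hx (hsub x hx h) hxy.symm
        · rw [Function.update_of_ne hxv, Function.update_of_ne hyv]
          exact hc1.2 x hx y hy hxy
    · intro x hx
      by_cases hxv : x = v
      · subst hxv
        rw [Function.update_self, hvi]
        intro _
        exact ⟨le_rfl, h3.le, hiP, hjP⟩
      · rw [Function.update_of_ne hxv]
        intro h
        obtain ⟨a1, a2, a3, a4⟩ := hch x hx h
        exact ⟨by omega, by omega, a3, a4⟩
    · intro x hx
      by_cases hxv : x = v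
      · subst hxv; intro _; exact hvi
      · rw [Function.update_of_ne hxv]
        intro h
        by_contra hne
        have := (hch x hx (by rw [h]; exact fun h => hne h.symm)).2.1
        rw [h] at this; omega
    · intro l
      rw [card_cls_update U c1 v hvU i j hv1 l, hcard l]

/-! ### Part 3: the Hajnal–Szemerédi theorem (after Kierstead and Kostochka) -/

/-- Recolour the vertices with colours in `B` by `g`. -/
def mg (B : Finset ℕ) (c g : V → ℕ) (x : V) : ℕ := if c x ∈ B then g x else c x

theorem cls_mg_notMem (U : Finset V) (B : Finset ℕ) (c g : V → ℕ)
    (hg : ∀ x ∈ U, c x ∈ B → g x ∈ B) (l : ℕ) (hl : l ∉ B) :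
    cls U (mg B c g) l = cls U c l := by
  unfold cls mg
  apply Finset.filter_congr
  intro x hx
  have := hg x hx
  grind

theorem cls_mg_mem (U : Finset V) (B : Finset ℕ) (c g : V → ℕ) (l : ℕ) (hl : l ∈ B) :
    cls U (mg B c g) l = cls (U.filter fun x => c x ∈ B) g l := by
  ext x
  simp only [mem_cls, mg, Finset.mem_filter]
  grind

theorem nb_split (H : SimpleGraph V) (U : Finset V) (A B : Finset ℕ) (hAB : Disjoint A B)
    (c : V → ℕ) (hc : ∀ v ∈ U, c v ∈ A ∪ B) (v : V) :
    #(nb H U v) = ∑ i ∈ A, #(nb H (cls U c i) v) + #(nb H (U.filter fun x => c x ∈ B) v) := by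
  classical
  have h1 : #(nb H (U.filter fun x => c x ∈ A) v) = ∑ i ∈ A, #(nb H (cls U c i) v) := by
    rw [Finset.card_eq_sum_card_fiberwise (f := c) (t := A)]
    · apply Finset.sum_congr rfl
      intro i hi
      congr 1
      ext x
      simp only [mem_nb, mem_cls, Finset.mem_filter]
      grind
    · intro x hx
      simp only [Finset.mem_coe, mem_nb, Finset.mem_filter] at hx
      exact hx.1.2
  rw [← h1, ← Finset.card_union_of_disjoint]
  · congr 1
    ext x
    have := hc x
    simp only [mem_nb, Finset.mem_filter, Finset.mem_union] at *
    grind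
  · rw [Finset.disjoint_left]
    intro x hx hx'
    simp only [mem_nb, Finset.mem_filter] at hx hx'
    exact Finset.disjoint_left.1 hAB hx.1.2 hx'.1.2

theorem nb_mono (H : SimpleGraph V) {S T : Finset V} (h : S ⊆ T) (v : V) :
    #(nb H S v) ≤ #(nb H T v) := by
  apply Finset.card_le_card
  intro x hx
  rw [mem_nb] at *
  exact ⟨h hx.1, hx.2⟩

/-- The situation in the proof: a nearly equitable colouring `c` with small class `a ∈ A` and
large class `b ∈ B`, where vertices coloured by `B` cannot be moved to classes in `A`. -/
structure Sit [DecidableEq V] (H : SimpleGraph V) (U : Finset V) (A B : Finset ℕ) (s : ℕ)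
    (c : V → ℕ) (a b : ℕ) : Prop where
  disj : Disjoint A B
  pc : PC H U (A ∪ B) c
  card : ∀ l ∈ A ∪ B, #(cls U c l) + (if l = a then 1 else 0) = s + (if l = b then 1 else 0)
  ha : a ∈ A
  hb : b ∈ B
  hB : ∀ y ∈ U, c y ∈ B → ∀ i ∈ A, ∃ w ∈ U, c w = i ∧ H.Adj y w
  deg : ∀ v ∈ U, #(nb H U v) < #A + #B
  IH : ∀ U' : Finset V, U' ⊂ U → ∀ C' : Finset ℕ, #U' = s * #C' →
    (∀ v ∈ U', #(nb H U' v) < #C') → Equit H U' C' s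

section
variable [DecidableEq V] {H : SimpleGraph V} {U : Finset V} {A B : Finset ℕ} {s : ℕ}
  {c : V → ℕ} {a b : ℕ}

theorem Sit.cardUB (S : Sit H U A B s c a b) : #(U.filter fun x => c x ∈ B) = s * #B + 1 := by
  rw [Finset.card_eq_sum_card_fiberwise (f := c) (t := B)]
  · have : ∀ i ∈ B, #((U.filter fun x => c x ∈ B).filter fun x => c x = i) =
        s + (if i = b then 1 else 0) := by
      intro i hi
      have h1 := S.card i (Finset.mem_union_right _ hi)
      have h2 : i ≠ a := by
        rintro rfl
        exact Finset.disjoint_left.1 S.disj S.ha hi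
      rw [if_neg h2] at h1
      rw [← h1, add_zero]
      congr 1
      ext x
      simp only [mem_cls, Finset.mem_filter]
      grind
    rw [Finset.sum_congr rfl this, Finset.sum_add_distrib, Finset.sum_ite_eq' B b, if_pos S.hb]
    simp [mul_comm]
  · intro x hx
    simp only [Finset.mem_coe, Finset.mem_filter] at hx
    exact hx.2

theorem Sit.one_le (S : Sit H U A B s c a b) {y : V} (hy : y ∈ U) (hyB : c y ∈ B) {i : ℕ}
    (hi : i ∈ A) : 1 ≤ #(nb H (cls U c i) y) := by
  obtain ⟨w, hw, hwi, hadj⟩ := S.hB y hy hyB i hi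
  exact Finset.card_pos.2 ⟨w, mem_nb.2 ⟨mem_cls.2 ⟨hw, hwi⟩, hadj⟩⟩

theorem Sit.degB (S : Sit H U A B s c a b) {y : V} (hy : y ∈ U) (hyB : c y ∈ B) :
    #(nb H (U.filter fun x => c x ∈ B) y) < #B := by
  have h1 := nb_split H U A B S.disj c S.pc.1 y
  have h2 := S.deg y hy
  have h3 : ∑ i ∈ A, 1 ≤ ∑ i ∈ A, #(nb H (cls U c i) y) :=
    Finset.sum_le_sum fun i hi => S.one_le hy hyB hi
  rw [← Finset.card_eq_sum_ones] at h3
  omega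

theorem Sit.exists_g (S : Sit H U A B s c a b) {y : V} (hy : y ∈ U) (hyB : c y ∈ B) :
    Equit H ((U.filter fun x => c x ∈ B).erase y) B s := by
  have hyUB : y ∈ U.filter fun x => c x ∈ B := Finset.mem_filter.2 ⟨hy, hyB⟩
  apply S.IH
  · exact (Finset.erase_ssubset hyUB).trans_subset (Finset.filter_subset _ _)
  · rw [Finset.card_erase_of_mem hyUB, S.cardUB]; simp
  · intro v hv
    have hv' := Finset.mem_filter.1 (Finset.mem_of_mem_erase hv)
    exact (nb_mono H (Finset.erase_subset _ _) v).trans_lt (S.degB hv'.1 hv'.2)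

/-- Accessible moves. -/
def RA (H : SimpleGraph V) (U : Finset V) (A : Finset ℕ) (c : V → ℕ) (i j : ℕ) : Prop :=
  i ∈ A ∧ j ∈ A ∧ Mv H U c i j

theorem Sit.case_one (S : Sit H U A B s c a b) {W X : ℕ} {y z : V} (hW : W ∈ A) (hX : X ∈ A)
    (hXW : X ≠ W) (hz : z ∈ U) (hzW : c z = W) (hy : y ∈ U) (hyB : c y ∈ B)
    (hsolo : ∀ w ∈ U, c w = W → H.Adj y w → w = z)
    (hmov : ∀ w ∈ U, c w = X → ¬ H.Adj z w)
    (hreach : Relation.ReflTransGen (Rav (RA H U A c) W) X a) :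
    Equit H U (A ∪ B) s := by
  obtain ⟨ρ, hρ⟩ := exists_rank (Rav (RA H U A c) W) a
  have hdj : ∀ i ∈ A, i ∉ B := fun i hi => Finset.disjoint_left.1 S.disj hi
  obtain ⟨c', hc', hch, hsub, hcard⟩ := shift H U (A ∪ B) c S.pc a (A.erase W)
    ((Finset.erase_subset _ _).trans Finset.subset_union_left) _
    (fun i j h => ⟨h.1.2.2, Finset.mem_erase.2 ⟨h.2.1, h.1.1⟩, Finset.mem_erase.2 ⟨h.2.2, h.1.2.1⟩⟩)
    ρ hρ _ X rfl hreach
  have hP : ∀ x ∈ U, c x ∉ A.erase W → c' x = c x := by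
    intro x hx h
    by_contra hne
    exact h (hch x hx hne).2.2.1
  have hP2 : ∀ x ∈ U, c' x ∉ A.erase W → c' x = c x := by
    intro x hx h
    by_contra hne
    exact h (hch x hx hne).2.2.2
  have hz' : c' z = W := by rw [hP z hz (by simp [hzW]), hzW]
  have hy' : c' y = c y := hP y hy (fun h => hdj _ (Finset.mem_of_mem_erase h) hyB)
  have hyz : y ≠ z := by rintro rfl; exact hdj W hW (hzW ▸ hyB)
  have hWc : ∀ x ∈ U, c' x = W → c x = W := by
    intro x hx h
    rw [← hP2 x hx (by simp [h]), h]
  set c2 := Function.update c' z X with hc2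
  have hy2 : c2 y = c y := by rw [hc2, Function.update_of_ne hyz, hy']
  set c3 := Function.update c2 y W with hc3
  have hcv : ∀ x, c3 x = if x = y then W else if x = z then X else c' x := by
    intro x
    simp only [hc3, hc2, Function.update_apply]
  have hcard3 : ∀ l, #(cls U c3 l) + (if l = c y then 1 else 0) =
      #(cls U c l) + (if l = a then 1 else 0) := by
    intro l
    have h1 := card_cls_update U c' z hz W X hz' l
    have h2 := card_cls_update U c2 y hy (c y) W hy2 l
    have h3 := hcard l
    rw [← hc2] at h1
    rw [← hc3] at h2
    omega
  have hB3 : (U.filter fun x => c3 x ∈ B) = (U.filter fun x => c x ∈ B).erase y := by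
    ext x
    simp only [Finset.mem_filter, Finset.mem_erase, hcv]
    by_cases hx : x ∈ U
    · have h1 := hP x hx
      have h2 := hP2 x hx
      by_cases hxy : x = y
      · simp [hxy, hdj W hW]
      · by_cases hxz : x = z
        · subst hxz
          simp [hxy, hdj X hX, hzW, hdj W hW]
        · simp only [hx, hxy, hxz, if_false, true_and, ne_eq, not_false_eq_true]
          constructor
          · intro h
            rwa [← h2 (fun h' => hdj _ (Finset.mem_of_mem_erase h') h)]
          · intro h
            rwa [h1 (fun h' => hdj _ (Finset.mem_of_mem_erase h') h)]
    · simp [hx]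
  have hprop : ∀ v ∈ U, ∀ w ∈ U, H.Adj v w → c3 v ≠ c3 w := by
    have key : ∀ w ∈ U, H.Adj y w → c3 w ≠ W := by
      intro w hw hadj
      rw [hcv, if_neg hadj.ne']
      split_ifs with h
      · exact hXW
      · intro h'
        exact h (hsolo w hw (hWc w hw h') hadj)
    have key2 : ∀ w ∈ U, w ≠ y → H.Adj z w → c3 w ≠ X := by
      intro w hw hwy hadj
      rw [hcv, if_neg hwy, if_neg hadj.ne']
      intro h'
      exact hmov w hw (hsub w hw h') hadj
    intro v hv w hw hadj
    by_cases h1 : v = y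
    · subst h1
      have := key w hw hadj
      rw [hcv v, if_pos rfl]; exact this.symm
    · by_cases h2 : w = y
      · subst h2
        have := key v hv hadj.symm
        rw [hcv w, if_pos rfl]; exact this
      · by_cases h3 : v = z
        · subst h3
          have := key2 w hw h2 hadj
          rw [hcv v, if_neg h1, if_pos rfl]; exact this.symm
        · by_cases h4 : w = z
          · subst h4
            have := key2 v hv h1 hadj.symm
            rw [hcv w, if_neg h2, if_pos rfl]; exact this
          · rw [hcv v, hcv w, if_neg h1, if_neg h2, if_neg h3, if_neg h4]
            exact hc'.2 v hv w hw hadj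
  obtain ⟨g, hg, hgc⟩ := S.exists_g hy hyB
  rw [← hB3] at hg hgc
  have hgB : ∀ x ∈ U, c3 x ∈ B → g x ∈ B := fun x hx h => hg.1 x (Finset.mem_filter.2 ⟨hx, h⟩)
  have hC3 : ∀ x ∈ U, c3 x ∈ A ∪ B := by
    intro x hx
    rw [hcv]
    split_ifs
    · exact Finset.mem_union_left _ hW
    · exact Finset.mem_union_left _ hX
    · exact hc'.1 x hx
  refine ⟨mg B c3 g, ⟨?_, ?_⟩, ?_⟩
  · intro x hx
    unfold mg
    split_ifs with h
    · exact Finset.mem_union_right _ (hgB x hx h)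
    · exact hC3 x hx
  · intro v hv w hw hadj
    unfold mg
    split_ifs with h1 h2 h2
    · exact hg.2 v (Finset.mem_filter.2 ⟨hv, h1⟩) w (Finset.mem_filter.2 ⟨hw, h2⟩) hadj
    · intro h; exact h2 (h ▸ hgB v hv h1)
    · intro h; exact h1 (h ▸ hgB w hw h2)
    · exact hprop v hv w hw hadj
  · intro l hl
    by_cases hlB : l ∈ B
    · rw [cls_mg_mem _ _ _ _ _ hlB]
      exact hgc l hlB
    · rw [cls_mg_notMem _ _ _ _ hgB _ hlB]
      have h1 := hcard3 l
      have h2 := S.card l hl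
      have h3 : l ≠ c y := by rintro rfl; exact hlB hyB
      have h4 : l ≠ b := by rintro rfl; exact hlB S.hb
      rw [if_neg h3] at h1
      rw [if_neg h4] at h2
      omega

theorem Sit.case_two (S : Sit H U A B s c a b) {W : ℕ} {y y' z : V} (hW : W ∈ A)
    (haW : a ≠ W) (hz : z ∈ U) (hzW : c z = W) (hy : y ∈ U) (hyB : c y ∈ B)
    (hy' : y' ∈ U) (hyB' : c y' ∈ B) (hne : y ≠ y') (hnadj : ¬ H.Adj y y')
    (hsolo : ∀ w ∈ U, c w = W → H.Adj y w → w = z)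
    (hsolo' : ∀ w ∈ U, c w = W → H.Adj y' w → w = z) (hyz : H.Adj y z)
    (hmov : ∀ X ∈ A, X ≠ W → ∃ w ∈ U, c w = X ∧ H.Adj z w)
    (hreach : ∀ i ∈ A, i ≠ W → Relation.ReflTransGen (Rav (RA H U A c) W) i a)
    (hWout : ∃ i ∈ A, i ≠ W ∧ Mv H U c W i) :
    ∃ c2 : V → ℕ, ∃ b2 ∈ B, PC H U (A ∪ B) c2 ∧
      (∀ l ∈ A ∪ B, #(cls U c2 l) + (if l = a then 1 else 0) = s + (if l = b2 then 1 else 0)) ∧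
      (∀ i ∈ A, Relation.ReflTransGen (RA H U (A ∪ B) c2) i a) ∧
      ∃ i ∈ B, Relation.ReflTransGen (RA H U (A ∪ B) c2) i a := by
  have hdj : ∀ i ∈ A, i ∉ B := fun i hi => Finset.disjoint_left.1 S.disj hi
  obtain ⟨g, hg, hgc⟩ := S.exists_g hy hyB
  have hyne : y ≠ z := hyz.ne
  -- the degree of `z` into the `B` part
  have hzdeg : #(nb H ((U.filter fun x => c x ∈ B).erase y) z) < #B := by
    have h1 := nb_split H U A B S.disj c S.pc.1 z
    have h2 := S.deg z hz
    have h3 : ∑ i ∈ A.erase W, 1 ≤ ∑ i ∈ A.erase W, #(nb H (cls U c i) z) := by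
      apply Finset.sum_le_sum
      intro i hi
      rw [Finset.mem_erase] at hi
      obtain ⟨w, hw, hwi, hadj⟩ := hmov i hi.2 hi.1
      exact Finset.card_pos.2 ⟨w, mem_nb.2 ⟨mem_cls.2 ⟨hw, hwi⟩, hadj⟩⟩
    rw [← Finset.card_eq_sum_ones, Finset.card_erase_of_mem hW] at h3
    have h4 : ∑ i ∈ A.erase W, #(nb H (cls U c i) z) ≤ ∑ i ∈ A, #(nb H (cls U c i) z) :=
      Finset.sum_le_sum_of_subset (Finset.erase_subset _ _)
    have h5 : nb H ((U.filter fun x => c x ∈ B).erase y) z =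
        (nb H (U.filter fun x => c x ∈ B) z).erase y := by
      ext x; simp only [mem_nb, Finset.mem_erase]; tauto
    have h6 : y ∈ nb H (U.filter fun x => c x ∈ B) z :=
      mem_nb.2 ⟨Finset.mem_filter.2 ⟨hy, hyB⟩, hyz.symm⟩
    rw [h5, Finset.card_erase_of_mem h6]
    have := Finset.card_pos.2 ⟨y, h6⟩
    have := Finset.card_pos.2 ⟨W, hW⟩
    omega
  obtain ⟨Y, hY, hYn⟩ : ∃ Y ∈ B, ∀ x ∈ (U.filter fun x => c x ∈ B).erase y,
      g x = Y → ¬ H.Adj z x := by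
    by_contra hcon
    push Not at hcon
    have : B ⊆ (nb H ((U.filter fun x => c x ∈ B).erase y) z).image g := by
      intro Y hY
      obtain ⟨x, hx, hgx, hadj⟩ := hcon Y hY
      exact Finset.mem_image.2 ⟨x, mem_nb.2 ⟨hx, hadj⟩, hgx⟩
    have := (Finset.card_le_card this).trans Finset.card_image_le
    omega
  set c1 := Function.update c y W with hc1
  have hc1v : ∀ x, c1 x = if x = y then W else c x := fun x => by
    simp only [hc1, Function.update_apply]
  have hB1 : (U.filter fun x => c1 x ∈ B) = (U.filter fun x => c x ∈ B).erase y := by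
    ext x
    simp only [Finset.mem_filter, Finset.mem_erase, hc1v]
    by_cases hxy : x = y
    · simp [hxy, hdj W hW]
    · simp [hxy]
  rw [← hB1] at hg hgc hYn
  have hgB : ∀ x ∈ U, c1 x ∈ B → g x ∈ B := fun x hx h => hg.1 x (Finset.mem_filter.2 ⟨hx, h⟩)
  have hz1 : c1 z = W := by rw [hc1v, if_neg hyne.symm, hzW]
  set c2 := Function.update (mg B c1 g) z Y with hc2
  have hmgz : mg B c1 g z = W := by unfold mg; rw [hz1, if_neg (hdj W hW)]
  have hc2v : ∀ x, c2 x = if x = z then Y else if c1 x ∈ B then g x else c1 x := fun x => by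
    simp only [hc2, Function.update_apply, mg]
  -- colours in A of the new colouring
  have hA2 : ∀ x ∈ U, ∀ i ∈ A, i ≠ W → (c2 x = i ↔ c x = i) := by
    intro x hx i hi hiW
    rw [hc2v, hc1v]
    have := hdj i hi
    have := hdj W hW
    have := hgB x hx
    rw [hc1v] at this
    grind
  have hW2 : ∀ x ∈ U, c2 x = W ↔ (x = y ∨ (c x = W ∧ x ≠ z)) := by
    intro x hx
    rw [hc2v, hc1v]
    have := hdj W hW
    have := hgB x hx
    rw [hc1v] at this
    grind
  have hpc : PC H U (A ∪ B) c2 := by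
    refine ⟨?_, ?_⟩
    · intro x hx
      rw [hc2v]
      split_ifs with h1 h2
      · exact Finset.mem_union_right _ hY
      · exact Finset.mem_union_right _ (hgB x hx h2)
      · rw [hc1v]
        split_ifs
        · exact Finset.mem_union_left _ hW
        · exact S.pc.1 x hx
    · have key : ∀ w ∈ U, H.Adj z w → c2 w ≠ Y := by
        intro w hw hadj
        rw [hc2v, if_neg hadj.ne']
        split_ifs with h
        · intro h'
          exact hYn w (Finset.mem_filter.2 ⟨hw, h⟩) h' hadj
        · intro h'; exact h (h' ▸ hY)
      intro v hv w hw hadj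
      by_cases h1 : v = z
      · subst h1
        have := key w hw hadj
        rw [hc2v v, if_pos rfl]; exact this.symm
      by_cases h2 : w = z
      · subst h2
        have := key v hv hadj.symm
        rw [hc2v w, if_pos rfl]; exact this
      rw [hc2v v, hc2v w, if_neg h1, if_neg h2]
      split_ifs with h3 h4 h4
      · exact hg.2 v (Finset.mem_filter.2 ⟨hv, h3⟩) w (Finset.mem_filter.2 ⟨hw, h4⟩) hadj
      · intro h; exact h4 (h ▸ hgB v hv h3)
      · intro h; exact h3 (h ▸ hgB w hw h4)
      · rw [hc1v, hc1v]
        split_ifs with h5 h6 h6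
        · exact absurd (h5.trans h6.symm) hadj.ne
        · intro h
          subst h5
          exact h2 (hsolo w hw h.symm hadj)
        · intro h
          subst h6
          exact h1 (hsolo v hv h hadj.symm)
        · exact S.pc.2 v hv w hw hadj
  have hcard : ∀ l ∈ A ∪ B, #(cls U c2 l) + (if l = a then 1 else 0) =
      s + (if l = Y then 1 else 0) := by
    intro l hl
    have h1 := card_cls_update U (mg B c1 g) z hz W Y hmgz l
    rw [← hc2] at h1
    by_cases hlB : l ∈ B
    · rw [cls_mg_mem _ _ _ _ _ hlB, hgc l hlB] at h1
      have e1 : l ≠ a := by rintro rfl; exact hdj _ S.ha hlB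
      have e2 : l ≠ W := by rintro rfl; exact hdj _ hW hlB
      rw [if_neg e2] at h1
      rw [if_neg e1]
      omega
    · rw [cls_mg_notMem _ _ _ _ hgB _ hlB] at h1
      have h2 := card_cls_update U c y hy (c y) W rfl l
      rw [← hc1] at h2
      have h3 := S.card l hl
      have e1 : l ≠ c y := by rintro rfl; exact hlB hyB
      have e2 : l ≠ b := by rintro rfl; exact hlB S.hb
      have e3 : l ≠ Y := by rintro rfl; exact hlB hY
      rw [if_neg e1] at h2
      rw [if_neg e2] at h3
      rw [if_neg e3] at h1 ⊢
      omega
  have hr1 : ∀ i ∈ A, i ≠ W → Relation.ReflTransGen (RA H U (A ∪ B) c2) i a := by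
    intro i hi hiW
    refine Relation.ReflTransGen.mono ?_ _ _ (hreach i hi hiW)
    rintro i j ⟨⟨h1, h2, v, hv, hvi, hvn⟩, h4, h5⟩
    refine ⟨Finset.mem_union_left _ h1, Finset.mem_union_left _ h2, v, hv, ?_, ?_⟩
    · exact (hA2 v hv i h1 h4).2 hvi
    · intro w hw h
      exact hvn w hw ((hA2 w hw j h2 h5).1 h)
  have hr2 : Relation.ReflTransGen (RA H U (A ∪ B) c2) W a := by
    obtain ⟨i, hi, hiW, v, hv, hvW, hvn⟩ := hWout
    refine .head ⟨Finset.mem_union_left _ hW, Finset.mem_union_left _ hi, v, hv, ?_, ?_⟩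
      (hr1 i hi hiW)
    · refine (hW2 v hv).2 (Or.inr ⟨hvW, ?_⟩)
      rintro rfl
      obtain ⟨w, hw, hwi, hadj⟩ := hmov i hi hiW
      exact hvn w hw hwi hadj
    · intro w hw h
      exact hvn w hw ((hA2 w hw i hi hiW).1 h)
  refine ⟨c2, Y, hY, hpc, hcard, ?_, ?_⟩
  · intro i hi
    by_cases hiW : i = W
    · rw [hiW]; exact hr2
    · exact hr1 i hi hiW
  · have hy'1 : c1 y' ∈ B := by rw [hc1v, if_neg hne.symm]; exact hyB'
    have hy'z : y' ≠ z := by rintro rfl; exact hdj W hW (hzW ▸ hyB')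
    have hy'2 : c2 y' = g y' := by rw [hc2v, if_neg hy'z, if_pos hy'1]
    have hgy : g y' ∈ B := hgB y' hy' hy'1
    refine ⟨g y', hgy, .head ⟨Finset.mem_union_right _ hgy, Finset.mem_union_left _ hW,
      y', hy', hy'2, ?_⟩ hr2⟩
    intro w hw h hadj
    rcases (hW2 w hw).1 h with h | ⟨h1, h2⟩
    · subst h; exact hnadj hadj.symm
    · exact h2 (hsolo' w hw h1 hadj)

end

theorem nb_double (H : SimpleGraph V) (P Q : Finset V) :
    ∑ y ∈ P, #(nb H Q y) = ∑ z ∈ Q, #(nb H P z) := by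
  classical
  have := Finset.sum_card_bipartiteAbove_eq_sum_card_bipartiteBelow (s := P) (t := Q) H.Adj
  unfold Finset.bipartiteAbove Finset.bipartiteBelow at this
  unfold nb
  convert this using 4
  rename_i x _ y
  exact H.adj_comm _ _

/-- A maximal independent set dominates. -/
theorem exists_indep (H : SimpleGraph V) (P : Finset V) :
    ∃ I ⊆ P, (∀ x ∈ I, ∀ y ∈ I, ¬ H.Adj x y) ∧ #P ≤ ∑ y ∈ I, (#(nb H P y) + 1) := by
  classical
  let F := P.powerset.filter fun I => ∀ x ∈ I, ∀ y ∈ I, ¬ H.Adj x y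
  have hF : F.Nonempty := ⟨∅, by simp [F]⟩
  obtain ⟨I, hI, hmax⟩ := Finset.exists_max_image F Finset.card hF
  simp only [F, Finset.mem_filter, Finset.mem_powerset] at hI hmax
  refine ⟨I, hI.1, hI.2, ?_⟩
  have hcov : P ⊆ I.biUnion fun y => insert y (nb H P y) := by
    intro x hx
    by_contra hcon
    simp only [Finset.mem_biUnion, Finset.mem_insert, mem_nb, not_exists, not_and, not_or] at hcon
    have hxI : x ∉ I := fun h => (hcon x h).1 rfl
    have := hmax (insert x I) ⟨Finset.insert_subset hx hI.1, ?_⟩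
    · rw [Finset.card_insert_of_notMem hxI] at this; omega
    · intro y hy w hw hadj
      rw [Finset.mem_insert] at hy hw
      rcases hy with rfl | hy <;> rcases hw with rfl | hw
      · exact hadj.ne rfl
      · exact (hcon w hw).2 hx hadj.symm
      · exact (hcon y hy).2 hx hadj
      · exact hI.2 y hy w hw hadj
  calc #P ≤ _ := Finset.card_le_card hcov
    _ ≤ _ := Finset.card_biUnion_le
    _ ≤ _ := Finset.sum_le_sum fun y _ => Finset.card_insert_le _ _

section
variable [DecidableEq V] {H : SimpleGraph V} {U : Finset V} {A B : Finset ℕ} {s : ℕ}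
  {c : V → ℕ} {a b : ℕ}

/-- If `z` has a neighbour in all classes of `A₀ ⊆ A`, then its degree to the `B` part is small. -/
theorem Sit.degB_of (S : Sit H U A B s c a b) {z : V} (hz : z ∈ U) {A₀ : Finset ℕ} (hA₀ : A₀ ⊆ A)
    (h : ∀ X ∈ A₀, ∃ w ∈ U, c w = X ∧ H.Adj z w) :
    #(nb H (U.filter fun x => c x ∈ B) z) + #A₀ < #A + #B := by
  have h1 := nb_split H U A B S.disj c S.pc.1 z
  have h2 := S.deg z hz
  have h3 : ∑ i ∈ A₀, 1 ≤ ∑ i ∈ A₀, #(nb H (cls U c i) z) := by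
    apply Finset.sum_le_sum
    intro i hi
    obtain ⟨w, hw, hwi, hadj⟩ := h i hi
    exact Finset.card_pos.2 ⟨w, mem_nb.2 ⟨mem_cls.2 ⟨hw, hwi⟩, hadj⟩⟩
  rw [← Finset.card_eq_sum_ones] at h3
  have h4 : ∑ i ∈ A₀, #(nb H (cls U c i) z) ≤ ∑ i ∈ A, #(nb H (cls U c i) z) :=
    Finset.sum_le_sum_of_subset hA₀
  omega

theorem Sit.card_A (S : Sit H U A B s c a b) : ∃ i ∈ A, i ≠ a := by
  by_contra hcon
  push Not at hcon
  have hA : A = {a} := Finset.eq_singleton_iff_unique_mem.2 ⟨S.ha, hcon⟩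
  have h1 : ∑ y ∈ U.filter (fun x => c x ∈ B), 1 ≤
      ∑ y ∈ U.filter (fun x => c x ∈ B), #(nb H (cls U c a) y) := by
    apply Finset.sum_le_sum
    intro y hy
    rw [Finset.mem_filter] at hy
    exact S.one_le hy.1 hy.2 S.ha
  rw [← Finset.card_eq_sum_ones, S.cardUB, nb_double] at h1
  have h2 : ∑ z ∈ cls U c a, #(nb H (U.filter fun x => c x ∈ B) z) ≤ ∑ z ∈ cls U c a, #B := by
    apply Finset.sum_le_sum
    intro z hz
    have h3 := S.deg z (mem_cls.1 hz).1
    have h4 := nb_mono H (Finset.filter_subset (fun x => c x ∈ B) U) z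
    have h5 : #A = 1 := by rw [hA]; simp
    omega
  rw [Finset.sum_const, smul_eq_mul] at h2
  have h3 := S.card a (Finset.mem_union_left _ S.ha)
  have h4 : #(cls U c a) ≤ s := by
    have : a ≠ b := by
      rintro rfl; exact Finset.disjoint_left.1 S.disj S.ha S.hb
    rw [if_neg this] at h3
    omega
  have h5 := Nat.mul_le_mul_right #B h4
  omega

theorem Sit.lt_t (S : Sit H U A B s c a b) {A' : Finset ℕ} {u : ℕ} (hA' : A' ⊆ A)
    (haA' : a ∉ A')
    (hA'1 : ∀ x ∈ A', ∀ j ∈ A, j ∉ A' → j ≠ u → ¬ RA H U A c x j)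
    (hns : ∀ z ∈ U, c z ∈ A' → ∀ y ∈ U, c y ∈ B → nb H (cls U c (c z)) y = {z} →
      ∀ X ∈ A, X ≠ c z → ∃ w ∈ U, c w = X ∧ H.Adj z w)
    {W : ℕ} (hW : W ∈ A') : #B < #A' := by
  classical
  set UB := U.filter fun x => c x ∈ B with hUB
  let S1 := (cls U c W).filter fun z => ∃ y ∈ UB, nb H (cls U c W) y = {z}
  let D1 := (cls U c W).filter fun z => ¬ ∃ y ∈ UB, nb H (cls U c W) y = {z}
  have hSD : #S1 + #D1 = #(cls U c W) := Finset.card_filter_add_card_filter_not _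
  have hcW : #(cls U c W) = s := by
    have h := S.card W (Finset.mem_union_left _ (hA' hW))
    have e1 : W ≠ a := by rintro rfl; exact haA' hW
    have e2 : W ≠ b := by rintro rfl; exact Finset.disjoint_left.1 S.disj (hA' hW) S.hb
    rw [if_neg e1, if_neg e2] at h
    omega
  have hdS : ∀ z ∈ S1, #(nb H UB z) ≤ #B := by
    intro z hz
    simp only [S1, Finset.mem_filter, mem_cls] at hz
    obtain ⟨⟨hzU, hzW⟩, y, hy, hnb⟩ := hz
    rw [hUB, Finset.mem_filter] at hy
    have hAW : W ∈ A := hA' hW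
    have := S.degB_of hzU (Finset.erase_subset W A) (by
      intro X hX
      rw [Finset.mem_erase] at hX
      exact hns z hzU (hzW ▸ hW) y hy.1 hy.2 (hzW.symm ▸ hnb) X hX.2 (hzW.symm ▸ hX.1))
    rw [Finset.card_erase_of_mem hAW, ← hUB] at this
    have := Finset.card_pos.2 ⟨W, hAW⟩
    omega
  have hdD : ∀ z ∈ D1, #(nb H UB z) ≤ #B + #A' := by
    intro z hz
    simp only [D1, Finset.mem_filter, mem_cls] at hz
    obtain ⟨⟨hzU, hzW⟩, _⟩ := hz
    have := S.degB_of hzU ((Finset.erase_subset u (A \ A')).trans Finset.sdiff_subset) (by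
      intro X hX
      rw [Finset.mem_erase, Finset.mem_sdiff] at hX
      by_contra hcon
      push Not at hcon
      exact hA'1 W hW X hX.2.1 hX.2.2 hX.1 ⟨hA' hW, hX.2.1, z, hzU, hzW, hcon⟩)
    rw [← hUB] at this
    have h1 := Finset.pred_card_le_card_erase (s := A \ A') (a := u)
    have h2 := Finset.card_sdiff_add_card_eq_card hA'
    omega
  have hy2 : ∀ y ∈ UB, 2 ≤ 2 * #(nb H S1 y) + #(nb H D1 y) := by
    intro y hy
    by_cases h0 : (nb H S1 y).Nonempty
    · have := Finset.card_pos.2 h0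
      omega
    · rw [Finset.not_nonempty_iff_eq_empty] at h0
      have hD : nb H D1 y = nb H (cls U c W) y := by
        ext x
        have hx : x ∉ nb H S1 y := by rw [h0]; simp
        simp only [mem_nb, S1, D1, Finset.mem_filter] at hx ⊢
        tauto
      have h1 : 1 ≤ #(nb H (cls U c W) y) := by
        rw [hUB, Finset.mem_filter] at hy
        exact S.one_le hy.1 hy.2 (hA' hW)
      have h2 : #(nb H (cls U c W) y) ≠ 1 := by
        intro h
        obtain ⟨z, hz⟩ := Finset.card_eq_one.1 h
        have hzm : z ∈ nb H (cls U c W) y := by rw [hz]; simp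
        rw [mem_nb] at hzm
        have : z ∈ nb H S1 y := mem_nb.2 ⟨Finset.mem_filter.2 ⟨hzm.1, y, hy, hz⟩, hzm.2⟩
        rw [h0] at this
        simp at this
      rw [hD]
      omega
  have hsum := Finset.sum_le_sum hy2
  rw [Finset.sum_const, Finset.sum_add_distrib, ← Finset.mul_sum, nb_double H UB S1, nb_double H UB D1,
    S.cardUB] at hsum
  have h1 := Finset.sum_le_sum hdS
  have h2 := Finset.sum_le_sum hdD
  rw [Finset.sum_const, smul_eq_mul] at h1 h2
  rw [smul_eq_mul] at hsum
  by_contra hcon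
  push Not at hcon
  have h3 : #D1 * (#B + #A') ≤ #D1 * (2 * #B) := Nat.mul_le_mul_left _ (by omega)
  have h4 : (#S1 + #D1) * #B = s * #B := by rw [hSD, hcW]
  nlinarith

theorem Sit.exists_pair (S : Sit H U A B s c a b) {A' : Finset ℕ} {u : ℕ} (hA' : A' ⊆ A)
    (haA' : a ∉ A') (hA'n : A'.Nonempty)
    (hA'1 : ∀ x ∈ A', ∀ j ∈ A, j ∉ A' → j ≠ u → ¬ RA H U A c x j)
    (hns : ∀ z ∈ U, c z ∈ A' → ∀ y ∈ U, c y ∈ B → nb H (cls U c (c z)) y = {z} →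
      ∀ X ∈ A, X ≠ c z → ∃ w ∈ U, c w = X ∧ H.Adj z w) :
    ∃ z ∈ U, c z ∈ A' ∧ ∃ y ∈ U, ∃ y' ∈ U, c y ∈ B ∧ c y' ∈ B ∧ y ≠ y' ∧ ¬ H.Adj y y' ∧
      nb H (cls U c (c z)) y = {z} ∧ nb H (cls U c (c z)) y' = {z} := by
  classical
  obtain ⟨W, hW⟩ := hA'n
  have hlt := S.lt_t hA' haA' hA'1 hns hW
  set UB := U.filter fun x => c x ∈ B with hUB
  obtain ⟨I, hI, hind, hIcard⟩ := exists_indep H UB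
  set UA := U.filter fun x => c x ∈ A' with hUA
  have hcUA : #UA = s * #A' := by
    rw [Finset.card_eq_sum_card_fiberwise (f := c) (t := A')]
    · rw [mul_comm]
      apply Finset.sum_const_nat
      intro i hi
      have h := S.card i (Finset.mem_union_left _ (hA' hi))
      have e1 : i ≠ a := by rintro rfl; exact haA' hi
      have e2 : i ≠ b := by rintro rfl; exact Finset.disjoint_left.1 S.disj (hA' hi) S.hb
      rw [if_neg e1, if_neg e2, add_zero, add_zero] at h
      rw [← h]
      congr 1
      ext x
      simp only [hUA, mem_cls, Finset.mem_filter]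
      grind
    · intro x hx
      rw [hUA] at hx
      simp only [Finset.mem_coe, Finset.mem_filter] at hx
      exact hx.2
  -- number of solo neighbours
  have hsig : ∀ y ∈ I, #A' + #(nb H UB y) + 1 ≤
      #(UA.filter fun z => nb H (cls U c (c z)) y = {z}) + #B := by
    intro y hy
    have hyUB := hI hy
    rw [hUB, Finset.mem_filter] at hyUB
    have h1 := nb_split H U A B S.disj c S.pc.1 y
    rw [← hUB] at h1
    have h2 := S.deg y hyUB.1
    have h3 : ∑ i ∈ A, (if i ∈ A' ∧ #(nb H (cls U c i) y) ≠ 1 then 2 else 1) ≤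
        ∑ i ∈ A, #(nb H (cls U c i) y) := by
      apply Finset.sum_le_sum
      intro i hi
      have := S.one_le hyUB.1 hyUB.2 hi
      split_ifs <;> omega
    have h4 : ∑ i ∈ A, (if i ∈ A' ∧ #(nb H (cls U c i) y) ≠ 1 then 2 else 1) =
        #A + #(A'.filter fun i => #(nb H (cls U c i) y) ≠ 1) := by
      have e : ∀ i ∈ A, (if i ∈ A' ∧ #(nb H (cls U c i) y) ≠ 1 then 2 else 1) =
          1 + (if i ∈ A' ∧ #(nb H (cls U c i) y) ≠ 1 then 1 else 0) := by
        intro i _; split_ifs <;> rfl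
      rw [Finset.sum_congr rfl e, Finset.sum_add_distrib, ← Finset.card_eq_sum_ones,
        ← Finset.card_filter]
      congr 2
      ext i
      simp only [Finset.mem_filter]
      constructor
      · rintro ⟨_, h⟩; exact h
      · intro h; exact ⟨hA' h.1, h⟩
    have h5 : #(A'.filter fun i => #(nb H (cls U c i) y) = 1) +
        #(A'.filter fun i => #(nb H (cls U c i) y) ≠ 1) = #A' :=
      Finset.card_filter_add_card_filter_not _
    have h6 : #(A'.filter fun i => #(nb H (cls U c i) y) = 1) ≤
        #(UA.filter fun z => nb H (cls U c (c z)) y = {z}) := by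
      refine le_trans (Finset.card_le_card (t := (UA.filter fun z =>
        nb H (cls U c (c z)) y = {z}).image c) ?_) Finset.card_image_le
      intro i hi
      rw [Finset.mem_filter] at hi
      obtain ⟨z, hz⟩ := Finset.card_eq_one.1 hi.2
      have hzm : z ∈ nb H (cls U c i) y := by rw [hz]; simp
      rw [mem_nb, mem_cls] at hzm
      refine Finset.mem_image.2 ⟨z, Finset.mem_filter.2 ⟨Finset.mem_filter.2 ⟨hzm.1.1, ?_⟩, ?_⟩,
        hzm.1.2⟩
      · rw [hzm.1.2]; exact hi.1
      · rw [hzm.1.2]; exact hz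
    omega
  have hIs : s ≤ #I := by
    have h1 : ∑ y ∈ I, (#(nb H UB y) + 1) ≤ ∑ y ∈ I, #B := by
      apply Finset.sum_le_sum
      intro y hy
      have hyUB := hI hy
      rw [hUB, Finset.mem_filter] at hyUB
      exact S.degB hyUB.1 hyUB.2
    rw [Finset.sum_const, smul_eq_mul] at h1
    rw [S.cardUB] at hIcard
    by_contra hcon
    push Not at hcon
    have := Nat.mul_le_mul_right #B hcon.le
    omega
  have hsum := Finset.sum_le_sum hsig
  have hdc : ∑ y ∈ I, #(UA.filter fun z => nb H (cls U c (c z)) y = {z}) =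
      ∑ z ∈ UA, #(I.filter fun y => nb H (cls U c (c z)) y = {z}) :=
    Finset.sum_card_bipartiteAbove_eq_sum_card_bipartiteBelow
      (fun y z => nb H (cls U c (c z)) y = {z})
  have hbig : ∃ z ∈ UA, 1 < #(I.filter fun y => nb H (cls U c (c z)) y = {z}) := by
    by_contra hcon
    push Not at hcon
    have h1 := Finset.sum_le_sum hcon
    rw [← Finset.card_eq_sum_ones, ← hdc, hcUA] at h1
    have h2 : ∑ y ∈ I, (#A' + #(nb H UB y) + 1) = #I * #A' + ∑ y ∈ I, (#(nb H UB y) + 1) := by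
      rw [← smul_eq_mul, ← Finset.sum_const, ← Finset.sum_add_distrib]
      apply Finset.sum_congr rfl
      intros; ring
    rw [h2, Finset.sum_add_distrib (g := fun _ => #B)] at hsum
    rw [S.cardUB] at hIcard
    obtain ⟨d, hd⟩ := Nat.exists_eq_add_of_lt hlt
    obtain ⟨e, he⟩ := Nat.exists_eq_add_of_le hIs
    rw [Finset.sum_const, smul_eq_mul] at hsum
    rw [hd, he] at hsum
    rw [hd] at h1
    nlinarith
  obtain ⟨z, hz, hz2⟩ := hbig
  obtain ⟨y, hy, y', hy', hne⟩ := Finset.one_lt_card.1 hz2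
  rw [Finset.mem_filter] at hy hy' hz
  have hyU := hI hy.1
  have hyU' := hI hy'.1
  rw [hUB, Finset.mem_filter] at hyU hyU'
  exact ⟨z, hz.1, hz.2, y, hyU.1, y', hyU'.1, hyU.2, hyU'.2, hne, hind y hy.1 y' hy'.1,
    hy.2, hy'.2⟩

end

/-- The key lemma: from nearly equitable to equitable. -/
theorem near_to_equit [DecidableEq V] (H : SimpleGraph V) (U : Finset V) (C : Finset ℕ) (s : ℕ)
    (deg : ∀ v ∈ U, #(nb H U v) < #C)
    (IH : ∀ U' : Finset V, U' ⊂ U → ∀ C' : Finset ℕ, #U' = s * #C' →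
      (∀ v ∈ U', #(nb H U' v) < #C') → Equit H U' C' s) (a : ℕ) (ha : a ∈ C) :
    ∀ (k : ℕ) (c : V → ℕ) (b : ℕ), b ∈ C → PC H U C c →
      (∀ l ∈ C, #(cls U c l) + (if l = a then 1 else 0) = s + (if l = b then 1 else 0)) →
      (∃ A ⊆ C, (∀ i ∈ A, Relation.ReflTransGen (RA H U C c) i a) ∧ #C ≤ #A + k) →
      Equit H U C s := by
  classical
  intro k
  induction k using Nat.strong_induction_on with
  | _ k ih =>
  intro c b hb hc hcard ⟨A0, hA0C, hA0, hA0k⟩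
  let A := C.filter fun i => Relation.ReflTransGen (RA H U C c) i a
  have hA0A : A0 ⊆ A := fun i hi => Finset.mem_filter.2 ⟨hA0C hi, hA0 i hi⟩
  have hAk := Finset.card_le_card hA0A
  by_cases hbA : Relation.ReflTransGen (RA H U C c) b a
  · obtain ⟨ρ, hρ⟩ := exists_rank (RA H U C c) a
    obtain ⟨c', hc', -, -, hcd⟩ := shift H U C c hc a C le_rfl (RA H U C c)
      (fun i j h => ⟨h.2.2, h.1, h.2.1⟩) ρ hρ _ b rfl hbA
    refine ⟨c', hc', fun l hl => ?_⟩
    have h1 := hcd l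
    have h2 := hcard l hl
    omega
  let B := C \ A
  have hAB : A ∪ B = C := Finset.union_sdiff_of_subset (Finset.filter_subset _ _)
  have haA : a ∈ A := Finset.mem_filter.2 ⟨ha, .refl⟩
  have hcardAB : #A + #B = #C := by
    rw [← hAB, Finset.card_union_of_disjoint Finset.disjoint_sdiff]
  have hS : Sit H U A B s c a b :=
    { disj := Finset.disjoint_sdiff
      pc := by rw [hAB]; exact hc
      card := by rw [hAB]; exact hcard
      ha := haA
      hb := Finset.mem_sdiff.2 ⟨hb, fun h => hbA (Finset.mem_filter.1 h).2⟩
      hB := by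
        intro y hy hyB i hi
        by_contra hcon
        push Not at hcon
        have hyB' := Finset.mem_sdiff.1 hyB
        have hi' := Finset.mem_filter.1 hi
        exact hyB'.2 (Finset.mem_filter.2 ⟨hyB'.1, .head ⟨hyB'.1, hi'.1, y, hy, rfl, hcon⟩ hi'.2⟩)
      deg := by rw [hcardAB]; exact deg
      IH := IH }
  have hreachA : ∀ i ∈ A, Relation.ReflTransGen (RA H U A c) i a := by
    intro i hi
    have hi' := (Finset.mem_filter.1 hi).2
    clear hi
    induction hi' using Relation.ReflTransGen.head_induction_on with
    | refl => exact .refl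
    | head h1 h2 ih2 =>
      exact .head ⟨Finset.mem_filter.2 ⟨h1.1, .head h1 h2⟩, Finset.mem_filter.2 ⟨h1.2.1, h2⟩,
        h1.2.2⟩ ih2
  obtain ⟨u, A', hA'A, hA'n, haA', hterm, hA'1⟩ :=
    exists_terminal (RA H U A c) a A hreachA haA hS.card_A
  have soloD : ∀ z y, nb H (cls U c (c z)) y = {z} → ∀ w ∈ U, c w = c z → H.Adj y w → w = z := by
    intro z y h w hw hwz hadj
    have : w ∈ nb H (cls U c (c z)) y := mem_nb.2 ⟨mem_cls.2 ⟨hw, hwz⟩, hadj⟩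
    rw [h] at this
    simpa using this
  rw [← hAB]
  by_cases hns : ∀ z ∈ U, c z ∈ A' → ∀ y ∈ U, c y ∈ B → nb H (cls U c (c z)) y = {z} →
      ∀ X ∈ A, X ≠ c z → ∃ w ∈ U, c w = X ∧ H.Adj z w
  · obtain ⟨z, hz, hzA', y, hy, y', hy', hyB, hyB', hne, hnadj, hso, hso'⟩ :=
      hS.exists_pair hA'A haA' hA'n hA'1 hns
    have haW : a ≠ c z := by rintro h; exact haA' (h ▸ hzA')
    have hyz : H.Adj y z := by
      have : z ∈ nb H (cls U c (c z)) y := by rw [hso]; simp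
      exact (mem_nb.1 this).2
    have hWout : ∃ i ∈ A, i ≠ c z ∧ Mv H U c (c z) i := by
      obtain ⟨ρ, hρ⟩ := exists_rank (RA H U A c) a
      obtain ⟨j, h1, -, h3⟩ := hρ (c z) (hreachA _ (hA'A hzA')) haW.symm
      exact ⟨j, h1.2.1, by rintro rfl; omega, h1.2.2⟩
    obtain ⟨c2, b2, hb2, hpc2, hcard2, hr, i2, hi2, hr2⟩ :=
      hS.case_two (hA'A hzA') haW hz rfl hy hyB hy' hyB' hne hnadj (soloD z y hso)
        (soloD z y' hso') hyz (hns z hz hzA' y hy hyB hso) (hterm _ hzA') hWout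
    rw [hAB] at hpc2 hcard2 hr hr2 ⊢
    have hi2A : i2 ∉ A := (Finset.mem_sdiff.1 hi2).2
    have hi2C : i2 ∈ C := (Finset.mem_sdiff.1 hi2).1
    have hlt : #A < #C := by
      have := Finset.card_pos.2 ⟨i2, hi2⟩
      omega
    refine ih (k - 1) (by omega) c2 b2 (Finset.mem_sdiff.1 hb2).1 hpc2 hcard2
      ⟨insert i2 A, Finset.insert_subset hi2C (Finset.filter_subset _ _), ?_, ?_⟩
    · intro i hi
      rcases Finset.mem_insert.1 hi with rfl | hi
      · exact hr2
      · exact hr i hi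
    · rw [Finset.card_insert_of_notMem hi2A]
      omega
  · push Not at hns
    obtain ⟨z, hz, hzA', y, hy, hyB, hso, X, hX, hXne, hmov⟩ := hns
    exact hS.case_one (hA'A hzA') hX hXne hz rfl hy hyB (soloD z y hso) hmov
      (hterm _ hzA' X hX hXne)

theorem exists_equipartition [DecidableEq V] (s : ℕ) (C : Finset ℕ) :
    ∀ U : Finset V, #U = s * #C →
      ∃ c : V → ℕ, (∀ v ∈ U, c v ∈ C) ∧ ∀ i ∈ C, #(cls U c i) = s := by
  induction C using Finset.induction_on with
  | empty =>
    intro U hU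
    have : U = ∅ := by simpa using hU
    subst this
    exact ⟨fun _ => 0, by simp, by simp⟩
  | insert i C hi ih =>
    intro U hU
    rw [Finset.card_insert_of_notMem hi] at hU
    obtain ⟨T, hTU, hT⟩ := Finset.exists_subset_card_eq (s := U) (n := s) (by
      rw [hU]; exact Nat.le_mul_of_pos_right _ (by omega))
    obtain ⟨c, hc1, hc2⟩ := ih (U \ T) (by
      rw [Finset.card_sdiff_of_subset hTU, hU, hT, Nat.mul_succ]; omega)
    refine ⟨fun v => if v ∈ T then i else c v, ?_, ?_⟩
    · intro v hv
      dsimp only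
      split_ifs with h
      · simp
      · exact Finset.mem_insert_of_mem (hc1 v (Finset.mem_sdiff.2 ⟨hv, h⟩))
    · intro l hl
      by_cases hli : l = i
      · subst hli
        rw [← hT]
        congr 1
        ext x
        rw [mem_cls]
        constructor
        · rintro ⟨hx, h⟩
          by_contra hxT
          rw [if_neg hxT] at h
          exact hi (h ▸ hc1 x (Finset.mem_sdiff.2 ⟨hx, hxT⟩))
        · intro h; exact ⟨hTU h, if_pos h⟩
      · have hlC : l ∈ C := (Finset.mem_insert.1 hl).resolve_left hli
        rw [← hc2 l hlC]
        congr 1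
        ext x
        rw [mem_cls, mem_cls, Finset.mem_sdiff]
        by_cases hxT : x ∈ T
        · simp [hxT, Ne.symm hli]
        · simp [hxT]

/-- The graph `H` with only the edges inside `S` kept. -/
def restr (H : SimpleGraph V) (S : Finset V) : SimpleGraph V where
  Adj x y := H.Adj x y ∧ x ∈ S ∧ y ∈ S
  symm := ⟨fun _ _ h => ⟨h.1.symm, h.2.2, h.2.1⟩⟩
  loopless := ⟨fun _ h => h.1.ne rfl⟩

/-- **Hajnal–Szemerédi theorem.** -/
theorem hajnal_szemeredi [DecidableEq V] (N : ℕ) : ∀ (U : Finset V), #U = N →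
    ∀ (H : SimpleGraph V) (C : Finset ℕ) (s : ℕ), #U = s * #C →
      (∀ v ∈ U, #(nb H U v) < #C) → Equit H U C s := by
  induction N using Nat.strong_induction_on with
  | _ N IH =>
  intro U hUN H C s hU hdeg
  suffices hS : ∀ S : Finset V, S ⊆ U → Equit (restr H S) U C s by
    obtain ⟨c, hc, hcard⟩ := hS U le_rfl
    exact ⟨c, ⟨hc.1, fun v hv w hw h => hc.2 v hv w hw ⟨h, hv, hw⟩⟩, hcard⟩
  intro S
  induction S using Finset.induction_on with
  | empty =>
    intro _
    obtain ⟨c, hc1, hc2⟩ := exists_equipartition s C U hU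
    refine ⟨c, ⟨hc1, fun v hv w hw h => ?_⟩, hc2⟩
    have := h.2.1
    simp at this
  | insert v S hvS ih =>
    intro hSU
    obtain ⟨c, hc, hcard⟩ := ih ((Finset.subset_insert _ _).trans hSU)
    have hvU : v ∈ U := hSU (Finset.mem_insert_self _ _)
    set H' := restr H (insert v S) with hH'
    have hdeg' : ∀ w ∈ U, #(nb H' U w) < #C := by
      intro w hw
      refine lt_of_le_of_lt (Finset.card_le_card ?_) (hdeg w hw)
      intro x hx
      rw [mem_nb] at *
      exact ⟨hx.1, hx.2.1⟩
    obtain ⟨j, hj, hjn⟩ : ∃ j ∈ C, ∀ x ∈ U, c x = j → ¬ H'.Adj v x := by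
      by_contra hcon
      push Not at hcon
      have : C ⊆ (nb H' U v).image c := by
        intro j hj
        obtain ⟨x, hx, hcx, hadj⟩ := hcon j hj
        exact Finset.mem_image.2 ⟨x, mem_nb.2 ⟨hx, hadj⟩, hcx⟩
      have h1 := (Finset.card_le_card this).trans Finset.card_image_le
      have h2 := hdeg' v hvU
      omega
    have hold : ∀ x y, x ≠ v → y ≠ v → H'.Adj x y → (restr H S).Adj x y := by
      intro x y hx hy h
      exact ⟨h.1, (Finset.mem_insert.1 h.2.1).resolve_left hx,
        (Finset.mem_insert.1 h.2.2).resolve_left hy⟩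
    refine near_to_equit H' U C s hdeg' ?_ (c v) (hc.1 v hvU) (#C) (Function.update c v j) j hj
      ⟨?_, ?_⟩ ?_ ⟨∅, by simp, by simp, by simp⟩
    · intro U' hU' C' h1 h2
      exact IH #U' (by rw [← hUN]; exact Finset.card_lt_card hU') U' rfl H' C' s h1 h2
    · intro x hx
      by_cases hxv : x = v
      · subst hxv; rw [Function.update_self]; exact hj
      · rw [Function.update_of_ne hxv]; exact hc.1 x hx
    · intro x hx y hy hadj
      by_cases hxv : x = v
      · subst hxv
        rw [Function.update_self, Function.update_of_ne hadj.ne']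
        intro h
        exact hjn y hy h.symm hadj
      · by_cases hyv : y = v
        · subst hyv
          rw [Function.update_self, Function.update_of_ne hxv]
          intro h
          exact hjn x hx h hadj.symm
        · rw [Function.update_of_ne hxv, Function.update_of_ne hyv]
          exact hc.2 x hx y hy (hold x y hxv hyv hadj)
    · intro l hl
      rw [card_cls_update U c v hvU (c v) j rfl l, hcard l hl]

/-- Existence of clique tilings under a minimum degree condition. -/
theorem exists_tilingOn [DecidableEq V] (G : SimpleGraph V) (r : ℕ) (U : Finset V)
    (k : ℕ) (hU : #U = r * k) (hdeg : ∀ v ∈ U, #(nb Gᶜ U v) < k) :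
    ∃ T, IsKrTilingOn G r T U := by
  obtain ⟨c, hc, hcard⟩ := hajnal_szemeredi #U U rfl Gᶜ (Finset.range k) r (by simpa using hU)
    (by simpa using hdeg)
  refine ⟨(Finset.range k).image (cls U c), ?_, ?_, ?_⟩
  · intro K hK
    obtain ⟨i, hi, rfl⟩ := Finset.mem_image.1 hK
    rw [SimpleGraph.isNClique_iff]
    refine ⟨?_, hcard i hi⟩
    intro x hx y hy hne
    have hx' := mem_cls.1 (Finset.mem_coe.1 hx)
    have hy' := mem_cls.1 (Finset.mem_coe.1 hy)
    by_contra hadj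
    exact hc.2 x hx'.1 y hy'.1 ((SimpleGraph.compl_adj _ _ _).2 ⟨hne, hadj⟩) (hx'.2.trans hy'.2.symm)
  · intro K hK K' hK' hne
    obtain ⟨i, hi, rfl⟩ := Finset.mem_image.1 hK
    obtain ⟨j, hj, rfl⟩ := Finset.mem_image.1 hK'
    rw [Finset.disjoint_left]
    intro x hx hx'
    apply hne
    rw [← (mem_cls.1 hx).2, ← (mem_cls.1 hx').2]
  · ext x
    simp only [Finset.mem_biUnion, Finset.mem_image, id]
    constructor
    · rintro ⟨K, ⟨i, hi, rfl⟩, hx⟩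
      exact (mem_cls.1 hx).1
    · intro hx
      exact ⟨_, ⟨c x, hc.1 x hx, rfl⟩, mem_cls.2 ⟨hx, rfl⟩⟩

/-! ### Part 4: colour counts and switching gadgets -/

section
variable [DecidableEq V]

theorem kc_insert {q : ℕ} (f : Sym2 V → Fin q) (c : Fin q) (K : Finset V) (u : V) (hu : u ∉ K) :
    #((insert u K).sym2.filter fun e => ¬ e.IsDiag ∧ f e = c) =
      #(K.sym2.filter fun e => ¬ e.IsDiag ∧ f e = c) + #(K.filter fun w => f s(u, w) = c) := by
  have h1 : ((insert u K).sym2.filter fun e => ¬ e.IsDiag ∧ f e = c) =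
      (K.sym2.filter fun e => ¬ e.IsDiag ∧ f e = c) ∪
        (K.filter fun w => f s(u, w) = c).image fun w => s(u, w) := by
    ext e
    induction e using Sym2.ind with
    | _ x y =>
      simp only [Finset.mem_filter, Finset.mk_mem_sym2_iff, Finset.mem_insert, Finset.mem_union,
        Finset.mem_image, Sym2.mk_isDiag_iff, Sym2.eq_iff]
      constructor
      · rintro ⟨⟨hx, hy⟩, hne, hf⟩
        rcases hx with rfl | hx <;> rcases hy with rfl | hy
        · exact absurd rfl hne
        · exact Or.inr ⟨y, ⟨hy, hf⟩, Or.inl ⟨rfl, rfl⟩⟩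
        · exact Or.inr ⟨x, ⟨hx, by rw [Sym2.eq_swap]; exact hf⟩, Or.inr ⟨rfl, rfl⟩⟩
        · exact Or.inl ⟨⟨hx, hy⟩, hne, hf⟩
      · rintro (⟨⟨hx, hy⟩, hne, hf⟩ | ⟨w, ⟨hw, hf⟩, ⟨rfl, rfl⟩ | ⟨rfl, rfl⟩⟩)
        · exact ⟨⟨Or.inr hx, Or.inr hy⟩, hne, hf⟩
        · exact ⟨⟨Or.inl rfl, Or.inr hw⟩, by rintro rfl; exact hu hw, hf⟩
        · exact ⟨⟨Or.inr hw, Or.inl rfl⟩, by rintro rfl; exact hu hw,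
            by rw [Sym2.eq_swap]; exact hf⟩
  rw [h1, Finset.card_union_of_disjoint, Finset.card_image_of_injective]
  · intro x y h
    exact Sym2.congr_right.1 h
  · rw [Finset.disjoint_left]
    intro e he he'
    obtain ⟨w, hw, rfl⟩ := Finset.mem_image.1 he'
    rw [Finset.mem_filter, Finset.mk_mem_sym2_iff] at he
    exact hu he.1.1

theorem tiling_disjoint {G : SimpleGraph V} {r : ℕ} (hr : 0 < r) {T1 T2 : Finset (Finset V)}
    {S1 S2 : Finset V} (h1 : IsKrTilingOn G r T1 S1) (h2 : IsKrTilingOn G r T2 S2)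
    (hd : Disjoint S1 S2) : Disjoint T1 T2 := by
  rw [Finset.disjoint_left]
  intro K hK hK'
  have hc := (h1.1 K hK).card_eq
  obtain ⟨x, hx⟩ := Finset.card_pos.1 (by omega : 0 < #K)
  have m1 : x ∈ S1 := by rw [← h1.2.2]; exact Finset.mem_biUnion.2 ⟨K, hK, hx⟩
  have m2 : x ∈ S2 := by rw [← h2.2.2]; exact Finset.mem_biUnion.2 ⟨K, hK', hx⟩
  exact Finset.disjoint_left.1 hd m1 m2

theorem tiling_subset {G : SimpleGraph V} {r : ℕ} {T : Finset (Finset V)}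
    {S : Finset V} (h : IsKrTilingOn G r T S) {K : Finset V} (hK : K ∈ T) : K ⊆ S := by
  intro x hx
  rw [← h.2.2]; exact Finset.mem_biUnion.2 ⟨K, hK, hx⟩

theorem tiling_union {G : SimpleGraph V} {r : ℕ} {T1 T2 : Finset (Finset V)}
    {S1 S2 : Finset V} (h1 : IsKrTilingOn G r T1 S1) (h2 : IsKrTilingOn G r T2 S2)
    (hd : Disjoint S1 S2) : IsKrTilingOn G r (T1 ∪ T2) (S1 ∪ S2) := by
  refine ⟨?_, ?_, ?_⟩
  · intro K hK
    rcases Finset.mem_union.1 hK with h | h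
    · exact h1.1 K h
    · exact h2.1 K h
  · intro K hK K' hK' hne
    rcases Finset.mem_union.1 hK with h | h <;> rcases Finset.mem_union.1 hK' with h' | h'
    · exact h1.2.1 K h K' h' hne
    · exact Finset.disjoint_of_subset_left (tiling_subset h1 h)
        (Finset.disjoint_of_subset_right (tiling_subset h2 h') hd)
    · exact (Finset.disjoint_of_subset_left (tiling_subset h1 h')
        (Finset.disjoint_of_subset_right (tiling_subset h2 h) hd)).symm
    · exact h2.2.1 K h K' h' hne
  · rw [Finset.union_biUnion, h1.2.2, h2.2.2]

theorem colorCount_union {q : ℕ} (f : Sym2 V → Fin q) (c : Fin q) {T1 T2 : Finset (Finset V)}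
    (h : Disjoint T1 T2) :
    tilingColorCount f (T1 ∪ T2) c = tilingColorCount f T1 c + tilingColorCount f T2 c := by
  unfold tilingColorCount
  exact Finset.sum_union h

/-- A set of `2r` vertices having two tilings with different numbers of edges of colour `c`. -/
def Flex {q : ℕ} (G : SimpleGraph V) (r : ℕ) (f : Sym2 V → Fin q) (c : Fin q)
    (S : Finset V) : Prop :=
  #S = 2 * r ∧ ∃ T1 T2, IsKrTilingOn G r T1 S ∧ IsKrTilingOn G r T2 S ∧
    tilingColorCount f T1 c < tilingColorCount f T2 c

theorem flex_dichotomy {q : ℕ} (G : SimpleGraph V) (r : ℕ) (hr : 0 < r) (f : Sym2 V → Fin q)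
    (c : Fin q) (N : ℕ) :
    (∃ S T1 T2, #S = 2 * r * N ∧ IsKrTilingOn G r T1 S ∧ IsKrTilingOn G r T2 S ∧
      tilingColorCount f T1 c + N ≤ tilingColorCount f T2 c) ∨
    ∃ X : Finset V, #X ≤ 2 * r * N ∧ ∀ S, Disjoint S X → ¬ Flex G r f c S := by
  induction N with
  | zero =>
    left
    exact ⟨∅, ∅, ∅, by simp, by simp [IsKrTilingOn], by simp [IsKrTilingOn], by simp⟩
  | succ N ih =>
    rcases ih with ⟨S, T1, T2, hS, h1, h2, hc⟩ | ⟨X, hX, h⟩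
    · by_cases hex : ∃ S', Disjoint S' S ∧ Flex G r f c S'
      · obtain ⟨S', hd, hS', T1', T2', h1', h2', hc'⟩ := hex
        left
        refine ⟨S' ∪ S, T1' ∪ T1, T2' ∪ T2, ?_, tiling_union h1' h1 hd, tiling_union h2' h2 hd, ?_⟩
        · rw [Finset.card_union_of_disjoint hd, hS', hS]; ring
        · rw [colorCount_union f c (tiling_disjoint hr h1' h1 hd),
            colorCount_union f c (tiling_disjoint hr h2' h2 hd)]
          omega
      · push Not at hex
        right
        exact ⟨S, by rw [hS]; exact Nat.mul_le_mul_left _ (by omega), hex⟩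
    · right
      exact ⟨X, hX.trans (Nat.mul_le_mul_left _ (by omega)), h⟩

theorem gadget_tiling {G : SimpleGraph V} {r : ℕ} (hr : 0 < r) {u v : V} {K K' : Finset V}
    (huv : u ≠ v) (hK : G.IsNClique (r - 1) K) (hK' : G.IsNClique (r - 1) K')
    (hd : Disjoint K K') (huK : ∀ w ∈ K, G.Adj u w) (hvK' : ∀ w ∈ K', G.Adj v w)
    (huK' : u ∉ K') (hvK : v ∉ K) :
    IsKrTilingOn G r {insert u K, insert v K'} (insert u (insert v (K ∪ K'))) := by
  have e : r - 1 + 1 = r := by omega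
  have hdd : Disjoint (insert u K) (insert v K') := by
    rw [Finset.disjoint_left] at hd ⊢
    intro x hx hx'
    rw [Finset.mem_insert] at hx hx'
    rcases hx with rfl | hx <;> rcases hx' with rfl | hx'
    · exact huv rfl
    · exact huK' hx'
    · exact hvK hx
    · exact hd hx hx'
  refine ⟨?_, ?_, ?_⟩
  · intro L hL
    rw [Finset.mem_insert, Finset.mem_singleton] at hL
    rcases hL with rfl | rfl
    · rw [← e]; exact hK.insert huK
    · rw [← e]; exact hK'.insert hvK'
  · intro L hL L' hL' hne
    rw [Finset.mem_insert, Finset.mem_singleton] at hL hL'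
    rcases hL with rfl | rfl <;> rcases hL' with rfl | rfl
    · exact absurd rfl hne
    · exact hdd
    · exact hdd.symm
    · exact absurd rfl hne
  · ext x
    simp only [Finset.biUnion_insert, Finset.singleton_biUnion, id, Finset.mem_union,
      Finset.mem_insert]
    tauto

theorem gadget_count {q : ℕ} (f : Sym2 V → Fin q) (c : Fin q) {u v : V} {K K' : Finset V}
    (huv : u ≠ v) (huK : u ∉ K) (hvK' : v ∉ K') (huK' : u ∉ K') :
    tilingColorCount f {insert u K, insert v K'} c =
      #(K.sym2.filter fun e => ¬ e.IsDiag ∧ f e = c) + #(K.filter fun w => f s(u, w) = c) +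
      (#(K'.sym2.filter fun e => ¬ e.IsDiag ∧ f e = c) + #(K'.filter fun w => f s(v, w) = c)) := by
  unfold tilingColorCount
  rw [Finset.sum_pair, kc_insert f c K u huK, kc_insert f c K' v hvK']
  intro h
  have : u ∈ insert v K' := by rw [← h]; simp
  rw [Finset.mem_insert] at this
  exact this.elim huv huK'

theorem gadget_eq {q : ℕ} {G : SimpleGraph V} {r : ℕ} (hr : 0 < r) {f : Sym2 V → Fin q}
    {c : Fin q} {u v : V} {K K' : Finset V}
    (huv : u ≠ v) (hK : G.IsNClique (r - 1) K) (hK' : G.IsNClique (r - 1) K')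
    (hd : Disjoint K K') (huK : ∀ w ∈ K, G.Adj u w) (hvK' : ∀ w ∈ K', G.Adj v w)
    (huK' : ∀ w ∈ K', G.Adj u w) (hvK : ∀ w ∈ K, G.Adj v w)
    (hflex : ¬ Flex G r f c (insert u (insert v (K ∪ K')))) :
    #(K.filter fun w => f s(u, w) = c) + #(K'.filter fun w => f s(v, w) = c) =
      #(K.filter fun w => f s(v, w) = c) + #(K'.filter fun w => f s(u, w) = c) := by
  have a1 : u ∉ K := fun h => (huK u h).ne rfl
  have a2 : u ∉ K' := fun h => (huK' u h).ne rfl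
  have a3 : v ∉ K := fun h => (hvK v h).ne rfl
  have a4 : v ∉ K' := fun h => (hvK' v h).ne rfl
  have t1 := gadget_tiling hr huv hK hK' hd huK hvK' a2 a3
  have t2 := gadget_tiling hr huv.symm hK hK' hd hvK huK' a4 a1
  rw [Finset.insert_comm] at t2
  have c1 := gadget_count f c huv a1 a4 a2
  have c2 := gadget_count f c huv.symm a3 a2 a4
  have hcard : #(insert u (insert v (K ∪ K'))) = 2 * r := by
    rw [Finset.card_insert_of_notMem, Finset.card_insert_of_notMem,
      Finset.card_union_of_disjoint hd, hK.card_eq, hK'.card_eq]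
    · omega
    · simp [a3, a4]
    · simp [a1, a2, huv]
  rcases lt_trichotomy (tilingColorCount f {insert u K, insert v K'} c)
    (tilingColorCount f {insert v K, insert u K'} c) with h | h | h
  · exact absurd ⟨hcard, _, _, t1, t2, h⟩ hflex
  · omega
  · exact absurd ⟨hcard, _, _, t2, t1, h⟩ hflex

/-! ### Part 5: the structure of colourings without gadgets -/

theorem exists_clique {G : SimpleGraph V} {r : ℕ} {V' : Finset V}
    (hcom : ∀ J Z : Finset V, J ⊆ V' → #J ≤ r + 1 → #Z ≤ 3 * r →
      ∃ w ∈ V', w ∉ Z ∧ ∀ x ∈ J, G.Adj x w) (J Z : Finset V) (hJ : J ⊆ V') (hZ : #Z ≤ 3 * r) :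
    ∀ m : ℕ, #J + m ≤ r + 2 → ∃ L ⊆ V', G.IsNClique m L ∧ Disjoint L Z ∧
      ∀ x ∈ J, ∀ w ∈ L, G.Adj x w := by
  intro m
  induction m with
  | zero =>
    intro _
    exact ⟨∅, by simp, by simp, by simp, by simp⟩
  | succ m ih =>
    intro hm
    obtain ⟨L, hLV, hL, hLZ, hLJ⟩ := ih (by omega)
    obtain ⟨w, hw, hwZ, hwJ⟩ := hcom (J ∪ L) Z (Finset.union_subset hJ hLV) (by
      have := Finset.card_union_le J L
      rw [hL.card_eq] at this
      omega) hZ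
    refine ⟨insert w L, Finset.insert_subset hw hLV, hL.insert ?_, ?_, ?_⟩
    · intro b hb
      exact (hwJ b (Finset.mem_union_right _ hb)).symm
    · rw [Finset.disjoint_insert_left]; exact ⟨hwZ, hLZ⟩
    · intro x hx y hy
      rcases Finset.mem_insert.1 hy with rfl | hy
      · exact hwJ x (Finset.mem_union_left _ hx)
      · exact hLJ x hx y hy

theorem propP_adj {q : ℕ} {G : SimpleGraph V} {r : ℕ} (hr : 3 ≤ r) {f : Sym2 V → Fin q}
    {V' : Finset V}
    (hcom : ∀ J Z : Finset V, J ⊆ V' → #J ≤ r + 1 → #Z ≤ 3 * r →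
      ∃ w ∈ V', w ∉ Z ∧ ∀ x ∈ J, G.Adj x w)
    (hflex : ∀ c S, S ⊆ V' → ¬ Flex G r f c S)
    {u v w w' : V} (hu : u ∈ V') (hv : v ∈ V') (hw : w ∈ V') (hw' : w' ∈ V') (huv : u ≠ v)
    (h1 : G.Adj u w) (h2 : G.Adj v w) (h3 : G.Adj u w') (h4 : G.Adj v w') (h5 : G.Adj w w')
    (c : Fin q) :
    (if f s(u, w) = c then 1 else 0) + (if f s(v, w') = c then 1 else 0) =
      (if f s(v, w) = c then 1 else 0) + (if f s(u, w') = c then 1 else 0) := by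
  obtain ⟨L, hLV, hL, -, hLJ⟩ := exists_clique hcom {u, v, w, w'} ∅
    (by intro x hx; simp only [Finset.mem_insert, Finset.mem_singleton] at hx; grind)
    (by simp) (r - 2) (by
      have := Finset.card_le_four (a := u) (b := v) (c := w) (d := w')
      omega)
  have hr2 : r - 2 + 1 = r - 1 := by omega
  have hwL : w ∉ L := fun h => (hLJ w (by simp) w h).ne rfl
  have hwL' : w' ∉ L := fun h => (hLJ w' (by simp) w' h).ne rfl
  have hK1 : G.IsNClique (r - 1) (insert w L) := by
    rw [← hr2]; exact hL.insert fun b hb => hLJ w (by simp) b hb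
  have hK2 : G.IsNClique (r - 1) (insert w' L) := by
    rw [← hr2]; exact hL.insert fun b hb => hLJ w' (by simp) b hb
  obtain ⟨K', hKV, hK', hKZ, hKJ⟩ := exists_clique hcom {u, v} (insert w (insert w' L))
    (by intro x hx; simp only [Finset.mem_insert, Finset.mem_singleton] at hx; grind)
    (by
      have e1 := Finset.card_insert_le w (insert w' L)
      have e2 := Finset.card_insert_le w' L
      rw [hL.card_eq] at e2
      omega) (r - 1) (by
      have := Finset.card_le_two (a := u) (b := v)
      omega)
  have hd1 : Disjoint (insert w L) K' := by
    refine Finset.disjoint_of_subset_left ?_ hKZ.symm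
    intro x hx
    simp only [Finset.mem_insert] at hx ⊢
    tauto
  have hd2 : Disjoint (insert w' L) K' := by
    refine Finset.disjoint_of_subset_left ?_ hKZ.symm
    intro x hx
    simp only [Finset.mem_insert] at hx ⊢
    tauto
  have adj1 : ∀ x ∈ ({u, v} : Finset V), ∀ y ∈ insert w L, G.Adj x y := by
    intro x hx y hy
    rcases Finset.mem_insert.1 hy with rfl | hy
    · simp only [Finset.mem_insert, Finset.mem_singleton] at hx
      rcases hx with rfl | rfl <;> assumption
    · exact hLJ x (by simp only [Finset.mem_insert, Finset.mem_singleton] at hx ⊢; tauto) y hy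
  have adj2 : ∀ x ∈ ({u, v} : Finset V), ∀ y ∈ insert w' L, G.Adj x y := by
    intro x hx y hy
    rcases Finset.mem_insert.1 hy with rfl | hy
    · simp only [Finset.mem_insert, Finset.mem_singleton] at hx
      rcases hx with rfl | rfl <;> assumption
    · exact hLJ x (by simp only [Finset.mem_insert, Finset.mem_singleton] at hx ⊢; tauto) y hy
  have sub : ∀ x ∈ V', insert u (insert v (insert x L ∪ K')) ⊆ V' := by
    intro x hx y hy
    simp only [Finset.mem_insert, Finset.mem_union] at hy
    have := @hLV y
    have := @hKV y
    grind
  have g1 := gadget_eq (by omega) huv hK1 hK' hd1 (adj1 u (by simp)) (hKJ v (by simp))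
    (hKJ u (by simp)) (adj1 v (by simp)) (hflex c _ (sub w hw))
  have g2 := gadget_eq (by omega) huv hK2 hK' hd2 (adj2 u (by simp)) (hKJ v (by simp))
    (hKJ u (by simp)) (adj2 v (by simp)) (hflex c _ (sub w' hw'))
  have ins : ∀ x y : V, y ∉ L → #((insert y L).filter fun w => f s(x, w) = c) =
      #(L.filter fun w => f s(x, w) = c) + (if f s(x, y) = c then 1 else 0) := by
    intro x y hy
    rw [Finset.filter_insert]
    split_ifs with h
    · rw [Finset.card_insert_of_notMem (by simp [hy])]
    · rfl
  rw [ins u w hwL, ins v w hwL] at g1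
  rw [ins u w' hwL', ins v w' hwL'] at g2
  omega

/-- The main local property of gadget-free colourings. -/
theorem propP {q : ℕ} {G : SimpleGraph V} {r : ℕ} (hr : 3 ≤ r) {f : Sym2 V → Fin q}
    {V' : Finset V}
    (hcom : ∀ J Z : Finset V, J ⊆ V' → #J ≤ r + 1 → #Z ≤ 3 * r →
      ∃ w ∈ V', w ∉ Z ∧ ∀ x ∈ J, G.Adj x w)
    (hflex : ∀ c S, S ⊆ V' → ¬ Flex G r f c S)
    {u v w w' : V} (hu : u ∈ V') (hv : v ∈ V') (hw : w ∈ V') (hw' : w' ∈ V')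
    (h1 : G.Adj u w) (h2 : G.Adj v w) (h3 : G.Adj u w') (h4 : G.Adj v w') :
    (f s(u, w) = f s(v, w) ∧ f s(u, w') = f s(v, w')) ∨
    (f s(u, w) = f s(u, w') ∧ f s(v, w) = f s(v, w')) := by
  by_cases huv : u = v
  · subst huv; exact Or.inl ⟨rfl, rfl⟩
  obtain ⟨x, hx, -, hxJ⟩ := hcom {u, v, w, w'} ∅
    (by intro x hx; simp only [Finset.mem_insert, Finset.mem_singleton] at hx; grind)
    (by
      have := Finset.card_le_four (a := u) (b := v) (c := w) (d := w')
      omega) (by simp)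
  have b1 := propP_adj hr hcom hflex hu hv hw hx huv h1 h2 (hxJ u (by simp)) (hxJ v (by simp))
    (hxJ w (by simp))
  have b2 := propP_adj hr hcom hflex hu hv hw' hx huv h3 h4 (hxJ u (by simp)) (hxJ v (by simp))
    (hxJ w' (by simp))
  have key : ∀ c, (if f s(u, w) = c then 1 else 0) + (if f s(v, w') = c then 1 else 0) =
      (if f s(v, w) = c then 1 else 0) + (if f s(u, w') = c then 1 else 0) := by
    intro c
    have := b1 c
    have := b2 c
    omega
  have k1 := key (f s(u, w))
  have k2 := key (f s(v, w'))
  generalize f s(u, w) = p1 at *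
  generalize f s(v, w) = p2 at *
  generalize f s(u, w') = p3 at *
  generalize f s(v, w') = p4 at *
  grind

theorem structure_lemma {q : ℕ} {G : SimpleGraph V} {r : ℕ} (hr : 3 ≤ r) {f : Sym2 V → Fin q}
    {V' : Finset V} (hq : 0 < q)
    (hcom : ∀ J Z : Finset V, J ⊆ V' → #J ≤ r + 1 → #Z ≤ 3 * r →
      ∃ w ∈ V', w ∉ Z ∧ ∀ x ∈ J, G.Adj x w)
    (hflex : ∀ c S, S ⊆ V' → ¬ Flex G r f c S) :
    ∃ d : Fin q, ∃ B ⊆ V', (∀ x ∈ B, ∀ y ∈ B, ¬ G.Adj x y) ∧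
      ∀ x ∈ V', ∀ y ∈ V', x ∉ B → y ∉ B → G.Adj x y → f s(x, y) = d := by
  classical
  have P := @propP V _ q G r hr f V' hcom hflex
  have sw : ∀ x y, f s(x, y) = f s(y, x) := fun x y => by rw [Sym2.eq_swap]
  have com4 : ∀ x1 ∈ V', ∀ x2 ∈ V', ∀ x3 ∈ V', ∀ x4 ∈ V', ∃ w ∈ V', G.Adj x1 w ∧ G.Adj x2 w ∧
      G.Adj x3 w ∧ G.Adj x4 w := by
    intro x1 h1 x2 h2 x3 h3 x4 h4
    obtain ⟨x, hx, -, hxJ⟩ := hcom {x1, x2, x3, x4} ∅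
      (by intro x hx; simp only [Finset.mem_insert, Finset.mem_singleton] at hx; grind)
      (by
        have := Finset.card_le_four (a := x1) (b := x2) (c := x3) (d := x4)
        omega) (by simp)
    exact ⟨x, hx, hxJ _ (by simp), hxJ _ (by simp), hxJ _ (by simp), hxJ _ (by simp)⟩
  by_cases hcase : ∀ u ∈ V', ∀ v ∈ V', ∀ w ∈ V', G.Adj u w → G.Adj v w → f s(u, w) = f s(v, w)
  · by_cases hedge : ∃ x ∈ V', ∃ y ∈ V', G.Adj x y
    · obtain ⟨x, hx, y, hy, hxy⟩ := hedge
      refine ⟨f s(x, y), ∅, by simp, by simp, ?_⟩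
      intro x' hx' y' hy' _ _ hxy'
      obtain ⟨w, hw, w1, w2, w3, w4⟩ := com4 x hx y hy x' hx' y' hy'
      have e1 := hcase y' hy' w hw x' hx' hxy'.symm w3.symm
      have e2 := hcase x' hx' x hx w hw w3 w1
      have e3 := hcase w hw y hy x hx w1.symm hxy.symm
      rw [sw x' y', e1, sw w x', e2, sw x w, e3, sw]
    · push Not at hedge
      exact ⟨⟨0, hq⟩, ∅, by simp, by simp, fun x hx y hy _ _ h => absurd h (hedge x hx y hy)⟩
  push Not at hcase
  obtain ⟨u, hu, v, hv, w0, hw0, huw0, hvw0, hne⟩ := hcase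
  have hW : ∀ w ∈ V', G.Adj u w → G.Adj v w → f s(u, w) = f s(u, w0) := by
    intro w hw h1 h2
    rcases P hu hv hw hw0 h1 h2 huw0 hvw0 with h | h
    · exact absurd h.2 hne
    · exact h.1
  have hWW : ∀ w ∈ V', ∀ w' ∈ V', ∀ x ∈ V', G.Adj u w → G.Adj v w → G.Adj u w' → G.Adj v w' →
      G.Adj w x → G.Adj w' x → f s(w, x) = f s(w', x) := by
    intro w hw w' hw' x hx h1 h2 h3 h4 h5 h6
    have e1 := hW w hw h1 h2
    have e2 := hW w' hw' h3 h4
    rcases P hw hw' hx hu h5 h6 h1.symm h3.symm with h | h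
    · exact h.1
    · rw [h.1, h.2, sw w u, sw w' u, e1, e2]
  obtain ⟨w1, hw1, huw1, hvw1, hw01, -⟩ := com4 u hu v hv w0 hw0 w0 hw0
  have hmono : ∀ w ∈ V', ∀ w' ∈ V', G.Adj u w → G.Adj v w → G.Adj u w' → G.Adj v w' →
      G.Adj w w' → f s(w, w') = f s(w0, w1) := by
    intro w hw w' hw' h1 h2 h3 h4 h5
    obtain ⟨w3, hw3, a1, a2, a3, a4⟩ := com4 u hu v hv w' hw' w1 hw1
    have e1 := hWW w hw w3 hw3 w' hw' h1 h2 a1 a2 h5 a3.symm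
    have e2 := hWW w' hw' w1 hw1 w3 hw3 h3 h4 huw1 hvw1 a3 a4
    have e3 := hWW w3 hw3 w0 hw0 w1 hw1 a1 a2 huw0 hvw0 a4.symm hw01
    rw [e1, sw w3 w', e2, sw w1 w3, e3]
  set d := f s(w0, w1) with hd
  let inA : V → Prop := fun x => ∃ w ∈ V', G.Adj u w ∧ G.Adj v w ∧ G.Adj w x ∧ f s(w, x) = d
  have hA : ∀ x ∈ V', inA x → ∀ w ∈ V', G.Adj u w → G.Adj v w → G.Adj w x → f s(w, x) = d := by
    rintro x hx ⟨w', hw', h1, h2, h3, h4⟩ w hw h5 h6 h7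
    rw [hWW w hw w' hw' x hx h5 h6 h1 h2 h7 h3, h4]
  have main : ∀ x ∈ V', ∀ y ∈ V', G.Adj x y → ∃ w ∈ V', ∃ w' ∈ V', G.Adj u w ∧ G.Adj v w ∧
      G.Adj u w' ∧ G.Adj v w' ∧ G.Adj w y ∧ G.Adj w' x ∧
      ((f s(x, y) = f s(w, y) ∧ f s(w', x) = d) ∨ (f s(x, y) = f s(w', x) ∧ f s(w, y) = d)) := by
    intro x hx y hy hxy
    obtain ⟨w, hw, a1, a2, a3, a4⟩ := com4 u hu v hv x hx y hy
    obtain ⟨w', hw', b1, b2, b3, b4⟩ := com4 u hu v hv x hx w hw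
    refine ⟨w, hw, w', hw', a1, a2, b1, b2, a4.symm, b3.symm, ?_⟩
    have e := hmono w hw w' hw' a1 a2 b1 b2 b4
    rcases P hx hw hy hw' hxy a4.symm b3 b4 with h | h
    · left; exact ⟨h.1, by rw [sw, h.2, e]⟩
    · right; exact ⟨by rw [sw w' x]; exact h.1, by rw [h.2, e]⟩
  refine ⟨d, V'.filter fun x => ¬ inA x, Finset.filter_subset _ _, ?_, ?_⟩
  · intro x hx y hy hxy
    rw [Finset.mem_filter] at hx hy
    obtain ⟨w, hw, w', hw', a1, a2, a3, a4, a5, a6, h | h⟩ := main x hx.1 y hy.1 hxy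
    · exact hx.2 ⟨w', hw', a3, a4, a6, h.2⟩
    · exact hy.2 ⟨w, hw, a1, a2, a5, h.2⟩
  · intro x hx y hy hxB hyB hxy
    have hxA : inA x := by
      by_contra h; exact hxB (Finset.mem_filter.2 ⟨hx, h⟩)
    have hyA : inA y := by
      by_contra h; exact hyB (Finset.mem_filter.2 ⟨hy, h⟩)
    obtain ⟨w, hw, w', hw', a1, a2, a3, a4, a5, a6, h | h⟩ := main x hx y hy hxy
    · rw [h.1]; exact hA y hy hyA w hw a1 a2 a5
    · rw [h.1]; exact hA x hx hxA w' hw' a3 a4 a6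

end

/-! ### Part 5: counting and final assembly -/

section
variable [DecidableEq V]

theorem sum_colorCount {q : ℕ} (f : Sym2 V → Fin q) (T : Finset (Finset V)) :
    ∑ c, tilingColorCount f T c = tilingEdgeCount T := by
  unfold tilingColorCount tilingEdgeCount
  rw [Finset.sum_comm]
  refine Finset.sum_congr rfl fun K _ => ?_
  rw [Finset.card_eq_sum_card_fiberwise (f := f) (t := Finset.univ) (fun _ _ => by simp)]
  refine Finset.sum_congr rfl fun c _ => ?_
  rw [Finset.filter_filter]

theorem clique_edges (K : Finset V) :
    2 * #(K.sym2.filter fun e => ¬ e.IsDiag) = #K * (#K - 1) := by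
  induction K using Finset.induction_on with
  | empty => simp
  | insert a s ha ih =>
    have h := kc_insert (q := 1) (fun _ => 0) 0 s a ha
    simp only [and_true, Finset.filter_true] at h
    rw [h, Finset.card_insert_of_notMem ha, mul_add, ih]
    rcases Nat.eq_zero_or_pos (#s) with h0 | h0
    · simp [h0]
    · obtain ⟨m, hm⟩ : ∃ m, #s = m + 1 := ⟨#s - 1, by omega⟩
      rw [hm]; simp only [Nat.add_sub_cancel]; ring

theorem tiling_card {G : SimpleGraph V} {r : ℕ} {T : Finset (Finset V)} {S : Finset V}
    (h : IsKrTilingOn G r T S) : #T * r = #S := by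
  have h1 : #(T.biUnion id) = ∑ K ∈ T, #(id K) :=
    Finset.card_biUnion (fun K hK K' hK' hne => h.2.1 K hK K' hK' hne)
  rw [← h.2.2, h1, Finset.sum_congr rfl (fun K hK => show #(id K) = r from (h.1 K hK).card_eq),
    Finset.sum_const, smul_eq_mul]

theorem tiling_edges {G : SimpleGraph V} {r : ℕ} {T : Finset (Finset V)} {S : Finset V}
    (h : IsKrTilingOn G r T S) : 2 * tilingEdgeCount T = #S * (r - 1) := by
  unfold tilingEdgeCount
  rw [Finset.mul_sum, Finset.sum_congr rfl (fun K hK => by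
    rw [clique_edges, (h.1 K hK).card_eq]), Finset.sum_const, smul_eq_mul, ← tiling_card h, mul_assoc]

theorem tiling_count_ge {q : ℕ} {G : SimpleGraph V} {r : ℕ} {T : Finset (Finset V)}
    {S : Finset V} (h : IsKrTilingOn G r T S) (f : Sym2 V → Fin q) (d : Fin q) (Z : Finset V)
    (hZ : ∀ x ∈ S, ∀ y ∈ S, x ∉ Z → y ∉ Z → G.Adj x y → f s(x, y) = d) :
    tilingEdgeCount T ≤ tilingColorCount f T d + (r - 1) * #Z := by
  have key : ∀ K ∈ T, #(K.sym2.filter fun e => ¬ e.IsDiag) ≤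
      #(K.sym2.filter fun e => ¬ e.IsDiag ∧ f e = d) + (r - 1) * #(K ∩ Z) := by
    intro K hK
    have hsub : (K.sym2.filter fun e => ¬ e.IsDiag) ⊆
        (K.sym2.filter fun e => ¬ e.IsDiag ∧ f e = d) ∪
        (K ∩ Z).biUnion fun z => (K.erase z).image fun w => s(z, w) := by
      intro e
      induction e using Sym2.ind with
      | _ x y =>
        intro he
        rw [Finset.mem_filter, Finset.mk_mem_sym2_iff, Sym2.mk_isDiag_iff] at he
        obtain ⟨⟨hx, hy⟩, hne⟩ := he
        rw [Finset.mem_union]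
        by_cases hxZ : x ∈ Z
        · right
          exact Finset.mem_biUnion.2 ⟨x, Finset.mem_inter.2 ⟨hx, hxZ⟩, Finset.mem_image.2
            ⟨y, Finset.mem_erase.2 ⟨Ne.symm hne, hy⟩, rfl⟩⟩
        by_cases hyZ : y ∈ Z
        · right
          exact Finset.mem_biUnion.2 ⟨y, Finset.mem_inter.2 ⟨hy, hyZ⟩, Finset.mem_image.2
            ⟨x, Finset.mem_erase.2 ⟨hne, hx⟩, Sym2.eq_swap⟩⟩
        left
        rw [Finset.mem_filter, Finset.mk_mem_sym2_iff, Sym2.mk_isDiag_iff]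
        exact ⟨⟨hx, hy⟩, hne, hZ x (tiling_subset h hK hx) y (tiling_subset h hK hy) hxZ hyZ
          ((h.1 K hK).isClique hx hy hne)⟩
    refine (Finset.card_le_card hsub).trans ((Finset.card_union_le _ _).trans ?_)
    refine Nat.add_le_add_left ?_ _
    rw [mul_comm]
    refine Finset.card_biUnion_le_card_mul _ _ _ fun z hz => ?_
    refine Finset.card_image_le.trans ?_
    rw [Finset.card_erase_of_mem (Finset.mem_inter.1 hz).1, (h.1 K hK).card_eq]
  have hs : ∑ K ∈ T, #(K ∩ Z) ≤ #Z := by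
    rw [← Finset.card_biUnion]
    · refine Finset.card_le_card fun x hx => ?_
      obtain ⟨K, _, hx⟩ := Finset.mem_biUnion.1 hx
      exact (Finset.mem_inter.1 hx).2
    · intro K hK K' hK' hne
      exact Finset.disjoint_of_subset_left Finset.inter_subset_left
        (Finset.disjoint_of_subset_right Finset.inter_subset_left (h.2.1 K hK K' hK' hne))
  unfold tilingEdgeCount tilingColorCount
  refine (Finset.sum_le_sum key).trans ?_
  rw [Finset.sum_add_distrib, ← Finset.mul_sum]
  exact Nat.add_le_add_left (Nat.mul_le_mul_left _ hs) _

/-- Tiling a set from a bound on the number of non-neighbours. -/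
theorem tilingOn_of_nonadj [Fintype V] (G : SimpleGraph V) [DecidableRel G.Adj] (r D k : ℕ)
    (hD : ∀ v, #(Finset.univ.filter fun w => ¬ G.Adj v w) ≤ D) (U : Finset V)
    (hU : #U = r * k) (hk : D ≤ k) : ∃ T, IsKrTilingOn G r T U := by
  refine exists_tilingOn G r U k hU fun v hv => ?_
  refine lt_of_lt_of_le (Finset.card_lt_card ?_) ((hD v).trans hk)
  rw [Finset.ssubset_iff_of_subset]
  · exact ⟨v, by simp, fun h => by simpa using (mem_nb.1 h).2⟩
  · intro w hw
    have := (mem_nb.1 hw).2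
    rw [SimpleGraph.compl_adj] at this
    simpa using this.2

/-- Two perfect tilings with different counts give discrepancy. -/
theorem disc_of_two {q : ℕ} (f : Sym2 V → Fin q) (T1 T2 : Finset (Finset V)) (c : Fin q)
    (hE : tilingEdgeCount T1 = tilingEdgeCount T2) (t : ℝ)
    (ht : (tilingColorCount f T1 c : ℝ) + t ≤ tilingColorCount f T2 c) :
    (∃ d, ((tilingEdgeCount T1 : ℝ) + t) / q ≤ tilingColorCount f T1 d) ∨
      ∃ d, ((tilingEdgeCount T2 : ℝ) + t) / q ≤ tilingColorCount f T2 d := by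
  have hq : (0 : ℝ) < q := by
    have := c.pos
    exact_mod_cast this
  by_contra hcon
  push Not at hcon
  obtain ⟨h1, h2⟩ := hcon
  have hs : (∑ d, (tilingColorCount f T1 d : ℝ)) = tilingEdgeCount T1 := by
    exact_mod_cast sum_colorCount f T1
  have hle : ∑ d ∈ Finset.univ.erase c, (tilingColorCount f T1 d : ℝ) ≤
      ∑ d ∈ (Finset.univ : Finset (Fin q)).erase c, ((tilingEdgeCount T1 : ℝ) + t) / q :=
    Finset.sum_le_sum fun d _ => (h1 d).le
  rw [Finset.sum_const, Finset.card_erase_of_mem (Finset.mem_univ c), Finset.card_univ,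
    Fintype.card_fin, nsmul_eq_mul, Nat.cast_sub c.pos, Nat.cast_one] at hle
  rw [← Finset.add_sum_erase _ _ (Finset.mem_univ c)] at hs
  have h3 := h2 c
  rw [← hE] at h3
  have e : ((q : ℝ) - 1) * (((tilingEdgeCount T1 : ℝ) + t) / q) =
      ((tilingEdgeCount T1 : ℝ) + t) - ((tilingEdgeCount T1 : ℝ) + t) / q := by
    field_simp
  rw [e] at hle
  linarith

/-- Few vertices leave common neighbours for `J` in the complement of `X`. -/
theorem common_nbr [Fintype V] (G : SimpleGraph V) [DecidableRel G.Adj] (r D : ℕ)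
    (hD : ∀ v, #(Finset.univ.filter fun w => ¬ G.Adj v w) ≤ D) (X J Z : Finset V)
    (hJ : #J ≤ r + 1) (hZ : #Z ≤ 3 * r)
    (hn : #X + (r + 1) * D + 3 * r < Fintype.card V) :
    ∃ w ∈ Finset.univ \ X, w ∉ Z ∧ ∀ x ∈ J, G.Adj x w := by
  by_contra hcon
  push Not at hcon
  have hsub : (Finset.univ : Finset V) ⊆
      X ∪ (Z ∪ J.biUnion fun v => Finset.univ.filter fun w => ¬ G.Adj v w) := by
    intro w _
    by_cases hX : w ∈ X
    · exact Finset.mem_union_left _ hX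
    refine Finset.mem_union_right _ ?_
    by_cases hZ' : w ∈ Z
    · exact Finset.mem_union_left _ hZ'
    refine Finset.mem_union_right _ ?_
    obtain ⟨x, hx, hxw⟩ := hcon w (by simp [hX]) hZ'
    exact Finset.mem_biUnion.2 ⟨x, hx, by simpa using hxw⟩
  have h1 := Finset.card_le_card hsub
  have h2 := Finset.card_union_le X (Z ∪ J.biUnion fun v => Finset.univ.filter fun w => ¬ G.Adj v w)
  have h3 := Finset.card_union_le Z (J.biUnion fun v => Finset.univ.filter fun w => ¬ G.Adj v w)
  have h4 : #(J.biUnion fun v => Finset.univ.filter fun w => ¬ G.Adj v w) ≤ #J * D :=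
    Finset.card_biUnion_le_card_mul _ _ _ fun v _ => hD v
  have h5 := Nat.mul_le_mul_right D hJ
  rw [Finset.card_univ] at h1
  omega

/-- Combinatorial core, with all numerical assumptions explicit. -/
theorem core [Fintype V] (G : SimpleGraph V) [DecidableRel G.Adj] (r q D N k : ℕ) (hr : 3 ≤ r)
    (hq : 2 ≤ q) (hD : ∀ v, #(Finset.univ.filter fun w => ¬ G.Adj v w) ≤ D)
    (hk : Fintype.card V = r * k) (h1 : D + 2 * N ≤ k)
    (h2 : q * (2 * r * N) + (r + 1) * D + 3 * r < Fintype.card V)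
    (f : Sym2 V → Fin q) (t : ℝ) (ht : t ≤ N)
    (hfin : (((Fintype.card V * (r - 1) : ℕ) : ℝ) / 2 + t) / q +
      (((r - 1) * (q * (2 * r * N) + D) : ℕ) : ℝ) ≤ ((Fintype.card V * (r - 1) : ℕ) : ℝ) / 2) :
    ∃ T : Finset (Finset V), IsKrTiling G r T ∧
      ∃ c : Fin q, ((tilingEdgeCount T : ℝ) + t) / q ≤ (tilingColorCount f T c : ℝ) := by
  have hE : ∀ T, IsKrTiling G r T →
      (tilingEdgeCount T : ℝ) = ((Fintype.card V * (r - 1) : ℕ) : ℝ) / 2 := by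
    intro T hT
    have := tiling_edges hT
    rw [Finset.card_univ] at this
    rw [← this]; push_cast; ring
  by_cases hA : ∃ c, ∃ S T1 T2, #S = 2 * r * N ∧ IsKrTilingOn G r T1 S ∧ IsKrTilingOn G r T2 S ∧
      tilingColorCount f T1 c + N ≤ tilingColorCount f T2 c
  · obtain ⟨c, S, T1, T2, hS, hT1, hT2, hc⟩ := hA
    have hUc : #(Finset.univ \ S) = r * (k - 2 * N) := by
      rw [Finset.card_sdiff_of_subset (Finset.subset_univ _), Finset.card_univ, hk, hS,
        Nat.mul_sub]
      congr 1; ring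
    obtain ⟨T0, hT0⟩ := tilingOn_of_nonadj G r D (k - 2 * N) hD _ hUc (by omega)
    have hdis : Disjoint S (Finset.univ \ S) := Finset.disjoint_sdiff
    have t1 : IsKrTiling G r (T1 ∪ T0) := by
      have := tiling_union hT1 hT0 hdis
      rwa [Finset.union_sdiff_of_subset (Finset.subset_univ _)] at this
    have t2 : IsKrTiling G r (T2 ∪ T0) := by
      have := tiling_union hT2 hT0 hdis
      rwa [Finset.union_sdiff_of_subset (Finset.subset_univ _)] at this
    have e1 : tilingEdgeCount (T1 ∪ T0) = tilingEdgeCount (T2 ∪ T0) := by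
      have := hE _ t1
      rw [← hE _ t2] at this
      exact_mod_cast this
    have hcc : tilingColorCount f (T1 ∪ T0) c + N ≤ tilingColorCount f (T2 ∪ T0) c := by
      rw [colorCount_union f c (tiling_disjoint (by omega) hT1 hT0 hdis),
        colorCount_union f c (tiling_disjoint (by omega) hT2 hT0 hdis)]
      omega
    have hcr : (tilingColorCount f (T1 ∪ T0) c : ℝ) + t ≤ tilingColorCount f (T2 ∪ T0) c := by
      have : (tilingColorCount f (T1 ∪ T0) c : ℝ) + N ≤ tilingColorCount f (T2 ∪ T0) c := by
        exact_mod_cast hcc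
      linarith
    rcases disc_of_two f _ _ c e1 t hcr with h | h
    · exact ⟨_, t1, h⟩
    · exact ⟨_, t2, h⟩
  · have hB : ∀ c, ∃ X : Finset V, #X ≤ 2 * r * N ∧ ∀ S, Disjoint S X → ¬ Flex G r f c S := by
      intro c
      rcases flex_dichotomy G r (by omega) f c N with h | h
      · exact absurd ⟨c, h⟩ hA
      · exact h
    choose X hX1 hX2 using hB
    have hXc : #(Finset.univ.biUnion X) ≤ q * (2 * r * N) := by
      have := Finset.card_biUnion_le_card_mul Finset.univ X (2 * r * N) (fun c _ => hX1 c)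
      rwa [Finset.card_univ, Fintype.card_fin] at this
    set Y := Finset.univ.biUnion X with hY
    obtain ⟨d, B, hBV, hBi, hBd⟩ := structure_lemma (G := G) (f := f) (V' := Finset.univ \ Y) hr
      (by omega)
      (fun J Z _ hJ hZ => common_nbr G r D hD Y J Z hJ hZ (by omega))
      (fun c S hS => hX2 c S (by
        rw [Finset.disjoint_left]
        intro x hx hx'
        exact (Finset.mem_sdiff.1 (hS hx)).2 (Finset.mem_biUnion.2 ⟨c, Finset.mem_univ _, hx'⟩)))
    have hBc : #B ≤ D := by
      rcases B.eq_empty_or_nonempty with rfl | ⟨b, hb⟩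
      · simp
      · exact (Finset.card_le_card fun x hx => by simpa using hBi b hb x hx).trans (hD b)
    obtain ⟨T, hT⟩ := tilingOn_of_nonadj G r D k hD Finset.univ
      (by rw [Finset.card_univ, hk]) (by omega)
    refine ⟨T, hT, d, ?_⟩
    have hge := tiling_count_ge hT f d (Y ∪ B) (by
      intro x _ y _ hx hy hxy
      rw [Finset.mem_union, not_or] at hx hy
      exact hBd x (by simp [hx.1]) y (by simp [hy.1]) hx.2 hy.2 hxy)
    have hZc : #(Y ∪ B) ≤ q * (2 * r * N) + D :=
      (Finset.card_union_le _ _).trans (Nat.add_le_add hXc hBc)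
    have hge2 : tilingEdgeCount T ≤ tilingColorCount f T d + (r - 1) * (q * (2 * r * N) + D) :=
      hge.trans (Nat.add_le_add_left (Nat.mul_le_mul_left _ hZc) _)
    have hge3 : (tilingEdgeCount T : ℝ) ≤ tilingColorCount f T d +
        (((r - 1) * (q * (2 * r * N) + D) : ℕ) : ℝ) := by exact_mod_cast hge2
    rw [hE T hT] at hge3 ⊢
    linarith

end

/-- **Theorem (δ_{r,q} ≤ r/(r+1)).** For all `r ≥ 3`, `q ≥ 2` and `ε > 0` there are `ζ > 0`
and `n₀` such that for all `n ≥ n₀` with `r ∣ n`: any `q`-edge-colored `n`-vertex graph with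
minimum degree at least `(r/(r+1) + ε)n` has a `K_r`-tiling of discrepancy at least `ζn`. -/
theorem delta_rq_le_r_div_r_add_one (r q : ℕ) (hr : 3 ≤ r) (hq : 2 ≤ q)
    (ε : ℝ) (hε : 0 < ε) :
    ∃ ζ : ℝ, 0 < ζ ∧ ∃ n₀ : ℕ, ∀ n : ℕ, n₀ ≤ n → r ∣ n →
      ∀ (G : SimpleGraph (Fin n)) [DecidableRel G.Adj],
        ((r : ℝ) / (r + 1) + ε) * n ≤ G.minDegree →
        ∀ f : Sym2 (Fin n) → Fin q,
          ∃ T : Finset (Finset (Fin n)), IsKrTiling G r T ∧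
            ∃ c : Fin q,
              ((tilingEdgeCount T : ℝ) + ζ * n) / q ≤ (tilingColorCount f T c : ℝ) := by
  have hr0 : (3 : ℝ) ≤ r := by exact_mod_cast hr
  have hq0 : (2 : ℝ) ≤ q := by exact_mod_cast hq
  have hrq : (0 : ℝ) < 8 * r * q := by positivity
  set ζ : ℝ := ε / (8 * r * q) with hζ
  have hζ0 : 0 < ζ := by positivity
  have hζe : ζ * (8 * r * q) = ε := by rw [hζ]; field_simp
  refine ⟨ζ, hζ0, ⌈1 / ζ⌉₊ + ⌈2 / ε⌉₊ + 1, ?_⟩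
  intro n hn hrn G _ hdeg f
  have hn1 : 1 ≤ ζ * n := by
    have h : 1 / ζ ≤ (n : ℝ) := (Nat.le_ceil _).trans (by exact_mod_cast (by omega))
    rw [div_le_iff₀ hζ0] at h
    linarith
  have hn2 : 2 ≤ ε * n := by
    have h : 2 / ε ≤ (n : ℝ) := (Nat.le_ceil _).trans (by exact_mod_cast (by omega))
    rw [div_le_iff₀ hε] at h
    linarith
  have hnpos : 0 < n := by omega
  obtain ⟨k, hk⟩ := hrn
  have hml : G.minDegree ≤ n := by
    have := G.minDegree_le_degree ⟨0, hnpos⟩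
    have h2 := G.degree_lt_card_verts ⟨0, hnpos⟩
    rw [Fintype.card_fin] at h2
    omega
  obtain ⟨D, hDdef⟩ : ∃ D, D + G.minDegree = n := ⟨n - G.minDegree, by omega⟩
  have hD : ∀ v, #(Finset.univ.filter fun w => ¬ G.Adj v w) ≤ D := by
    intro v
    have h1 := Finset.card_filter_add_card_filter_not
      (s := (Finset.univ : Finset (Fin n))) (fun w => G.Adj v w)
    rw [Finset.card_univ, Fintype.card_fin] at h1
    have h2 := G.minDegree_le_degree v
    rw [← G.card_neighborFinset_eq_degree v, G.neighborFinset_eq_filter] at h2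
    omega
  have hDr : ((r : ℝ) + 1) * D ≤ n - (r + 1) * (ε * n) := by
    have e : (D : ℝ) + G.minDegree = n := by exact_mod_cast hDdef
    have e2 : (D : ℝ) ≤ n - (r / (r + 1) + ε) * n := by linarith
    have hp : (0 : ℝ) < r + 1 := by linarith
    calc ((r : ℝ) + 1) * D ≤ (r + 1) * (n - (r / (r + 1) + ε) * n) :=
          mul_le_mul_of_nonneg_left e2 hp.le
      _ = n - (r + 1) * (ε * n) := by field_simp; ring
  set N := ⌈ζ * n⌉₊ with hN
  have hN1 : ζ * n ≤ N := Nat.le_ceil _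
  have hN2 : (N : ℝ) ≤ 2 * (ζ * n) := by
    have := Nat.ceil_lt_add_one (a := ζ * n) (by linarith)
    linarith
  have hrp : (0 : ℝ) < r := by linarith
  have hqp : (0 : ℝ) < q := by linarith
  have hb : (q : ℝ) * (2 * r * N) ≤ ε * n / 2 := by
    calc (q : ℝ) * (2 * r * N) ≤ q * (2 * r * (2 * (ζ * n))) := by gcongr
      _ = ζ * (8 * r * q) * n / 2 := by ring
      _ = ε * n / 2 := by rw [hζe]
  have hkr : (n : ℝ) = r * k := by exact_mod_cast hk
  have hD0 : (0 : ℝ) ≤ D := Nat.cast_nonneg _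
  have hN0 : (0 : ℝ) ≤ N := Nat.cast_nonneg _
  have hεn : 0 < ε * n := by linarith
  refine core G r q D N k hr hq hD (by rw [Fintype.card_fin, hk]) ?_ ?_ f (ζ * n) hN1 ?_
  · have h : (r : ℝ) * (D + 2 * N) ≤ r * k := by
      have h3 : 2 * r * (N : ℝ) ≤ q * (2 * r * N) := by
        have : 0 ≤ 2 * r * (N : ℝ) := by positivity
        nlinarith
      rw [← hkr]
      nlinarith
    exact_mod_cast le_of_mul_le_mul_left h hrp
  · rw [Fintype.card_fin]
    have h : (q : ℝ) * (2 * r * N) + (r + 1) * D + 3 * r < n := by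
      nlinarith
    exact_mod_cast h
  · rw [Fintype.card_fin]
    push_cast [Nat.cast_sub (by omega : 1 ≤ r)]
    have hDq : (D : ℝ) ≤ n / 4 - ε * n := by
      have h4 : (r + 1) * (D : ℝ) ≤ (r + 1) * (n / 4 - ε * n) := by
        nlinarith [(Nat.cast_nonneg n : (0 : ℝ) ≤ n)]
      exact le_of_mul_le_mul_left h4 (by linarith)
    have hz2 : ζ * n ≤ ε * n / 48 := by
      have h48 : ζ * 48 ≤ ε := by
        rw [← hζe]
        exact mul_le_mul_of_nonneg_left (by nlinarith) hζ0.le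
      nlinarith [(Nat.cast_nonneg n : (0 : ℝ) ≤ n)]
    have ha : ((n : ℝ) * (r - 1) / 2 + ζ * n) / q ≤ ((n : ℝ) * (r - 1) / 2 + ζ * n) / 2 := by
      apply div_le_div_of_nonneg_left _ (by norm_num) hq0
      have : 0 ≤ (n : ℝ) * (r - 1) := mul_nonneg (Nat.cast_nonneg n) (by linarith)
      linarith
    have hc : ((r : ℝ) - 1) * (q * (2 * r * N) + D) ≤ (r - 1) * (n / 4 - ε * n / 2) :=
      mul_le_mul_of_nonneg_left (by linarith) (by linarith)
    nlinarith
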